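/- Let p ≥ 3 and n ≥ 2 be integers and set N = np. Then, as polynomials in x, P_{[2,N−2],[p^n]}(x) = Σ_{i=0}^{n} (−1)^{n−i} C(n,i) [ 2x² · binom(x−2+pi, N−2) + x(x+1) · binom(x−2+pi, N−3) ], where [p^n] is the partition of N consisting of n parts equal to p. -/

import Mathlib

open Polynomial
open scoped Classical

/-- The cycle type of a permutation of `Fin n` as a partition of `n`,
including fixed points as parts equal to `1`. -/
noncomputable def fullCycleType {n : ℕ} (σ : Equiv.Perm (Fin n)) : Multiset ℕ :=
  σ.cycleType + Multiset.replicate (n - σ.cycleType.sum) 1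

/-- The number of disjoint cycles of a permutation, fixed points included. -/
noncomputable def numCycles {n : ℕ} (σ : Equiv.Perm (Fin n)) : ℕ :=
  Multiset.card (fullCycleType σ)

/-- The set (conjugacy class) of permutations of `Fin n` with full cycle type `β`. -/
noncomputable def permClass (n : ℕ) (β : Multiset ℕ) : Finset (Equiv.Perm (Fin n)) :=
  Finset.univ.filter (fun ω => fullCycleType ω = β)

/-- The polynomial `P_{[2,n-2],β}(x) = (n(n-1)/|C_β|) ⬝ Σ_{ρ(ω)=β} x^{κ(αω)}`. -/
noncomputable def Pperm {n : ℕ} (α : Equiv.Perm (Fin n)) (β : Multiset ℕ) : Polynomial ℚ :=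
  Polynomial.C (((n : ℚ) * ((n : ℚ) - 1)) / ((permClass n β).card : ℚ)) *
    ∑ ω ∈ permClass n β, Polynomial.X ^ (numCycles (α * ω))

/-- The polynomial `binom(x + c, k)` in `x`: for `k ≥ 0` it is
`(x+c)(x+c-1)⋯(x+c-k+1)/k!`, and it is `0` for `k < 0`. -/
noncomputable def binomPoly (c k : ℤ) : Polynomial ℚ :=
  if 0 ≤ k then
    (((k.toNat).factorial : ℚ))⁻¹ •
      ((descPochhammer ℚ k.toNat).comp (Polynomial.X + Polynomial.C (c : ℚ)))
  else 0

/-- The signless Stirling number of the first kind: the number of permutations of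
an `N`-element set with exactly `m` cycles (fixed points included). -/
noncomputable def stirling1 (N m : ℕ) : ℕ :=
  (Finset.univ.filter (fun σ : Equiv.Perm (Fin N) => numCycles σ = m)).card

/-- For a Young diagram with row lengths `L` (rows and columns 0-indexed),
the product `∏_{u} (t + c(u))` over the cells `u`, `c(u)` being the content. -/
def contentProd (L : List ℕ) (t : ℤ) : ℤ :=
  ∏ i ∈ Finset.range L.length, ∏ j ∈ Finset.range (L.getD i 0), (t + (j : ℤ) - (i : ℤ))

/-- `C(a, b)` for an integer `b`: the usual binomial coefficient when `b ≥ 0`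
(which is `0` for `b > a`), and `0` when `b < 0`. -/
def chooseZ (a : ℕ) (b : ℤ) : ℚ := if 0 ≤ b then (a.choose b.toNat : ℚ) else 0


namespace Equiv.Perm

set_option linter.unusedSectionVars false

variable {V W : Type} [Fintype V] [DecidableEq V] [Fintype W] [DecidableEq W]

/-- The length of the cycle of `σ` through `a`. -/
noncomputable def cycleLength (σ : Perm V) (a : V) : ℕ := Function.minimalPeriod σ a

/-- The multiset of cycle lengths of `σ`, fixed points included. -/
noncomputable def cycleLengths (σ : Perm V) : Multiset ℕ := σ.partition.parts

/-- The number of cycles of `σ`, fixed points included. -/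
noncomputable def cycleCount (σ : Perm V) : ℕ := Multiset.card σ.cycleLengths

theorem cycleLength_pos (σ : Perm V) (a : V) : 0 < σ.cycleLength a :=
  Function.minimalPeriod_pos_of_mem_periodicPts (σ.injective.mem_periodicPts a)

theorem pow_cycleLength (σ : Perm V) (a : V) : (σ ^ σ.cycleLength a) a = a := by
  rw [← iterate_eq_pow]
  exact Function.iterate_minimalPeriod

theorem pow_ne_of_lt_cycleLength {σ : Perm V} {a : V} {i : ℕ} (h0 : 0 < i)
    (h : i < σ.cycleLength a) : (σ ^ i) a ≠ a := by
  rw [← iterate_eq_pow]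
  exact Function.not_isPeriodicPt_of_pos_of_lt_minimalPeriod h0.ne' h

theorem pow_injOn_cycleLength (σ : Perm V) (a : V) :
    Set.InjOn (fun i : ℕ => (σ ^ i) a) (Set.Iio (σ.cycleLength a)) := by
  intro i hi j hj h
  simp only [← iterate_eq_pow] at h
  exact Function.iterate_injOn_Iio_minimalPeriod hi hj h

theorem SameCycle.exists_lt_cycleLength {σ : Perm V} {a x : V} (h : σ.SameCycle a x) :
    ∃ i < σ.cycleLength a, (σ ^ i) a = x := by
  obtain ⟨i, hi⟩ := h.exists_nat_pow_eq
  refine ⟨i % σ.cycleLength a, Nat.mod_lt _ (cycleLength_pos σ a), ?_⟩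
  rw [← hi, ← iterate_eq_pow, ← iterate_eq_pow]
  exact Function.iterate_mod_minimalPeriod_eq

theorem sameCycle_pow_apply (σ : Perm V) (a : V) (i : ℕ) : σ.SameCycle a ((σ ^ i) a) :=
  ⟨i, by simp⟩

theorem cycleLength_eq {σ : Perm V} {a : V} {k : ℕ} (hk : 0 < k) (h : (σ ^ k) a = a)
    (hlt : ∀ i, 0 < i → i < k → (σ ^ i) a ≠ a) : σ.cycleLength a = k := by
  have h1 : σ.cycleLength a ≤ k :=
    Function.IsPeriodicPt.minimalPeriod_le hk (by rw [Function.IsPeriodicPt, Function.IsFixedPt, iterate_eq_pow]; exact h)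
  have h2 : 0 < σ.cycleLength a := Function.IsPeriodicPt.minimalPeriod_pos hk
    (by rw [Function.IsPeriodicPt, Function.IsFixedPt, iterate_eq_pow]; exact h)
  by_contra hne
  exact hlt _ h2 (lt_of_le_of_ne h1 hne) (pow_cycleLength σ a)

theorem image_pow_range_cycleLength (σ : Perm V) (a : V) :
    (Finset.range (σ.cycleLength a)).image (fun i => (σ ^ i) a) =
      Finset.univ.filter (fun x => σ.SameCycle a x) := by
  ext x
  simp only [Finset.mem_image, Finset.mem_range, Finset.mem_filter, Finset.mem_univ, true_and]
  constructor
  · rintro ⟨i, -, rfl⟩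
    exact sameCycle_pow_apply σ a i
  · exact fun h => h.exists_lt_cycleLength

theorem sum_sameCycle {M : Type*} [AddCommMonoid M] (σ : Perm V) (a : V) (f : V → M) :
    ∑ x ∈ Finset.univ.filter (fun x => σ.SameCycle a x), f x =
      ∑ i ∈ Finset.range (σ.cycleLength a), f ((σ ^ i) a) := by
  rw [← image_pow_range_cycleLength, Finset.sum_image]
  intro i hi j hj h
  exact pow_injOn_cycleLength σ a (by simpa using hi) (by simpa using hj) h

theorem card_sameCycle (σ : Perm V) (a : V) :
    (Finset.univ.filter (fun x => σ.SameCycle a x)).card = σ.cycleLength a := by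
  rw [Finset.card_eq_sum_ones, sum_sameCycle]
  simp

theorem SameCycle.cycleLength_eq {σ : Perm V} {a x : V} (h : σ.SameCycle a x) :
    σ.cycleLength x = σ.cycleLength a := by
  classical
  rw [← card_sameCycle, ← card_sameCycle]
  congr 1
  ext y
  simp only [Finset.mem_filter, Finset.mem_univ, true_and]
  exact ⟨fun hy => h.trans hy, fun hy => h.symm.trans hy⟩

theorem sum_cycleLength {M : Type*} [AddCommMonoid M] (σ : Perm V) (f : ℕ → M) :
    ∑ x, f (σ.cycleLength x) = (σ.cycleLengths.map fun r => r • f r).sum := by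
  have hsupp : ∀ x ∈ σ.support, σ.cycleLength x = (σ.cycleOf x).support.card := by
    intro x hx
    rw [← card_sameCycle]
    congr 1
    ext y
    rw [Finset.mem_filter, mem_support_cycleOf_iff' (mem_support.1 hx)]
    simp
  rw [cycleLengths, parts_partition, Multiset.map_add, Multiset.sum_add,
    ← Finset.sum_add_sum_compl σ.support]
  congr 1
  · rw [cycleType_def, Multiset.map_map]
    change _ = ∑ c ∈ σ.cycleFactorsFinset, _
    rw [← Finset.sum_fiberwise_of_maps_to (s := σ.support) (t := σ.cycleFactorsFinset)
      (g := fun x => σ.cycleOf x) (fun x hx => cycleOf_mem_cycleFactorsFinset_iff.2 hx)]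
    refine Finset.sum_congr rfl fun c hc => ?_
    have hfib : σ.support.filter (fun x => σ.cycleOf x = c) = c.support := by
      ext x
      simp only [Finset.mem_filter]
      constructor
      · rintro ⟨hx, rfl⟩
        simpa using hx
      · intro hx
        exact ⟨mem_cycleFactorsFinset_support_le hc hx, (cycle_is_cycleOf hx hc).symm⟩
    rw [hfib, Finset.sum_congr rfl (g := fun _ => f c.support.card)]
    · simp
    · intro x hx
      rw [hsupp x (mem_cycleFactorsFinset_support_le hc hx), ← cycle_is_cycleOf hx hc]
  · rw [Finset.sum_congr rfl (g := fun _ => f 1)]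
    · simp [Finset.card_compl]
    · intro x hx
      have hx' : σ x = x := by simpa using hx
      rw [Equiv.Perm.cycleLength_eq (k := 1) one_pos (by simpa using hx') (by intro i; omega)]

theorem pos_of_mem_cycleLengths {σ : Perm V} {r : ℕ} (h : r ∈ σ.cycleLengths) : 0 < r :=
  σ.partition.parts_pos h

theorem sum_cycleLengths (σ : Perm V) : σ.cycleLengths.sum = Fintype.card V :=
  σ.partition.parts_sum

theorem _root_.Multiset.eq_of_sum_map_mul_eq {s t : Multiset ℕ} (hs : ∀ r ∈ s, 0 < r)
    (ht : ∀ r ∈ t, 0 < r)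
    (h : ∀ f : ℕ → ℕ, (s.map fun r => r • f r).sum = (t.map fun r => r • f r).sum) : s = t := by
  have key : ∀ (u : Multiset ℕ) (k : ℕ),
      (u.map fun r => r • if r = k then 1 else 0).sum = k * u.count k := by
    intro u k
    induction u using Multiset.induction_on with
    | empty => simp
    | cons a u ih =>
      rw [Multiset.map_cons, Multiset.sum_cons, ih, Multiset.count_cons]
      by_cases hak : a = k
      · subst hak; simp; ring
      · simp [hak, Ne.symm hak]
  ext k
  rcases Nat.eq_zero_or_pos k with rfl | hk
  · rw [Multiset.count_eq_zero_of_notMem fun h0 => lt_irrefl _ (hs 0 h0),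
      Multiset.count_eq_zero_of_notMem fun h0 => lt_irrefl _ (ht 0 h0)]
  · have := h fun r => if r = k then 1 else 0
    rw [key, key] at this
    exact Nat.eq_of_mul_eq_mul_left hk this

theorem cycleLength_mem (σ : Perm V) (a : V) : σ.cycleLength a ∈ σ.cycleLengths := by
  by_contra hn
  have h := sum_cycleLength σ fun r => if r = σ.cycleLength a then 1 else 0
  have h0 : (σ.cycleLengths.map fun r => r • if r = σ.cycleLength a then 1 else 0).sum = 0 := by
    refine Multiset.sum_eq_zero fun x hx => ?_
    obtain ⟨r, hr, rfl⟩ := Multiset.mem_map.1 hx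
    have : r ≠ σ.cycleLength a := fun h => hn (h ▸ hr)
    simp [this]
  rw [h0] at h
  have := Finset.sum_eq_zero_iff.1 h a (Finset.mem_univ a)
  simp at this

/-- Along a path avoiding `a` and `b`, multiplication by `swap a b` has no effect. -/
theorem swap_mul_pow_apply {σ : Perm V} {a b x : V} {j : ℕ}
    (h : ∀ i, 0 < i → i < j → (σ ^ i) x ≠ a ∧ (σ ^ i) x ≠ b) :
    ∀ i, i < j → ((swap a b * σ) ^ i) x = (σ ^ i) x := by
  intro i hi
  induction i with
  | zero => rfl
  | succ i ih =>
    have hne := h (i + 1) (Nat.succ_pos i) hi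
    rw [pow_succ', mul_apply, ih (Nat.lt_of_succ_lt hi), mul_apply, ← mul_apply σ, ← pow_succ',
      swap_apply_of_ne_of_ne hne.1 hne.2]

theorem swap_mul_pow_succ_apply {σ : Perm V} {a b x : V} {j : ℕ} (hj : 0 < j)
    (h : ∀ i, 0 < i → i < j → (σ ^ i) x ≠ a ∧ (σ ^ i) x ≠ b) :
    ((swap a b * σ) ^ j) x = swap a b ((σ ^ j) x) := by
  obtain ⟨k, rfl⟩ : ∃ k, j = k + 1 := ⟨j - 1, by omega⟩
  rw [pow_succ', mul_apply, swap_mul_pow_apply h k (Nat.lt_succ_self k), mul_apply, pow_succ' σ,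
    mul_apply]

section Merge

variable {σ : Perm V} {a b : V} (hab : ¬ σ.SameCycle a b)

include hab

theorem avoid_of_not_sameCycle :
    ∀ i, 0 < i → i < σ.cycleLength a → (σ ^ i) a ≠ a ∧ (σ ^ i) a ≠ b :=
  fun i h0 hi => ⟨pow_ne_of_lt_cycleLength h0 hi,
    fun h => hab (h ▸ sameCycle_pow_apply σ a i)⟩

theorem swap_mul_pow_apply_left (i : ℕ) (hi : i < σ.cycleLength a) :
    ((swap a b * σ) ^ i) a = (σ ^ i) a :=
  swap_mul_pow_apply (avoid_of_not_sameCycle hab) i hi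

theorem swap_mul_pow_cycleLength :
    ((swap a b * σ) ^ σ.cycleLength a) a = b := by
  rw [swap_mul_pow_succ_apply (cycleLength_pos σ a) (avoid_of_not_sameCycle hab),
    pow_cycleLength, swap_apply_left]

theorem swap_mul_pow_apply_right (i : ℕ) (hi : i < σ.cycleLength b) :
    ((swap a b * σ) ^ i) b = (σ ^ i) b := by
  rw [swap_comm]
  exact swap_mul_pow_apply_left (fun h => hab h.symm) i hi

theorem cycleLength_swap_mul :
    (swap a b * σ).cycleLength a = σ.cycleLength a + σ.cycleLength b := by
  have hba : ¬ σ.SameCycle b a := fun h => hab h.symm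
  have hshift : ∀ j, ((swap a b * σ) ^ (σ.cycleLength a + j)) a = ((swap a b * σ) ^ j) b := by
    intro j
    rw [add_comm, pow_add, mul_apply, swap_mul_pow_cycleLength hab]
  refine Equiv.Perm.cycleLength_eq (by have := cycleLength_pos σ a; omega) ?_ ?_
  · rw [hshift, swap_comm, swap_mul_pow_cycleLength hba]
  · intro i h0 hi
    rcases lt_or_ge i (σ.cycleLength a) with h | h
    · rw [swap_mul_pow_apply_left hab i h]
      exact pow_ne_of_lt_cycleLength h0 h
    · obtain ⟨j, rfl⟩ := Nat.exists_eq_add_of_le h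
      rw [hshift, swap_mul_pow_apply_right hab j (by omega)]
      exact fun h => hba (h ▸ sameCycle_pow_apply σ b j)

theorem sameCycle_swap_mul_left {x : V} (h : σ.SameCycle a x) : (swap a b * σ).SameCycle a x := by
  obtain ⟨i, hi, rfl⟩ := h.exists_lt_cycleLength
  rw [← swap_mul_pow_apply_left hab i hi]
  exact sameCycle_pow_apply _ _ _

theorem sameCycle_swap_mul_right {x : V} (h : σ.SameCycle b x) : (swap a b * σ).SameCycle a x := by
  have h1 : (swap a b * σ).SameCycle a b := by
    have := sameCycle_pow_apply (swap a b * σ) a (σ.cycleLength a)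
    rwa [swap_mul_pow_cycleLength hab] at this
  refine h1.trans ?_
  rw [swap_comm]
  exact sameCycle_swap_mul_left (fun h => hab h.symm) h

omit hab in
theorem cycleLength_swap_mul_of_not_sameCycle {x : V} (ha : ¬ σ.SameCycle a x)
    (hb : ¬ σ.SameCycle b x) : (swap a b * σ).cycleLength x = σ.cycleLength x := by
  have havoid : ∀ i, (σ ^ i) x ≠ a ∧ (σ ^ i) x ≠ b := fun i =>
    ⟨fun h => ha (h ▸ sameCycle_pow_apply σ x i).symm,
      fun h => hb (h ▸ sameCycle_pow_apply σ x i).symm⟩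
  have hpow : ∀ i, ((swap a b * σ) ^ i) x = (σ ^ i) x := fun i =>
    swap_mul_pow_apply (j := i + 1) (fun i _ _ => havoid i) i (Nat.lt_succ_self i)
  refine Equiv.Perm.cycleLength_eq (cycleLength_pos σ x) ?_ ?_
  · rw [hpow, pow_cycleLength]
  · intro i h0 hi
    rw [hpow]
    exact pow_ne_of_lt_cycleLength h0 hi

theorem cycleLengths_swap_mul :
    (swap a b * σ).cycleLengths + {σ.cycleLength a, σ.cycleLength b} =
      σ.cycleLengths + {σ.cycleLength a + σ.cycleLength b} := by
  have ha := cycleLength_pos σ a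
  have hb := cycleLength_pos σ b
  refine Multiset.eq_of_sum_map_mul_eq ?_ ?_ fun f => ?_
  · intro r hr
    simp only [Multiset.mem_add, Multiset.insert_eq_cons, Multiset.mem_cons,
      Multiset.mem_singleton] at hr
    rcases hr with hr | rfl | rfl
    · exact pos_of_mem_cycleLengths hr
    · exact ha
    · exact hb
  · intro r hr
    simp only [Multiset.mem_add, Multiset.mem_singleton] at hr
    rcases hr with hr | rfl
    · exact pos_of_mem_cycleLengths hr
    · omega
  · simp only [Multiset.map_add, Multiset.sum_add, ← sum_cycleLength]
    have hsplit : ∀ g : V → ℕ, ∑ x, g x = ∑ x ∈ Finset.univ.filter (fun x => σ.SameCycle a x), g x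
        + (∑ x ∈ Finset.univ.filter (fun x => σ.SameCycle b x), g x
        + ∑ x ∈ Finset.univ.filter (fun x => ¬ σ.SameCycle a x ∧ ¬ σ.SameCycle b x), g x) := by
      intro g
      rw [← Finset.sum_filter_add_sum_filter_not Finset.univ (fun x => σ.SameCycle a x) g]
      congr 1
      rw [← Finset.sum_filter_add_sum_filter_not _ (fun x => σ.SameCycle b x) g,
        Finset.filter_filter, Finset.filter_filter]
      congr 2
      ext x
      simp only [Finset.mem_filter, Finset.mem_univ, true_and, and_iff_right_iff_imp]
      exact fun h h' => hab (h'.trans h.symm)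
    rw [hsplit, hsplit fun x => f (σ.cycleLength x)]
    have hrest : ∑ x ∈ Finset.univ.filter (fun x => ¬ σ.SameCycle a x ∧ ¬ σ.SameCycle b x),
          f ((swap a b * σ).cycleLength x) =
        ∑ x ∈ Finset.univ.filter (fun x => ¬ σ.SameCycle a x ∧ ¬ σ.SameCycle b x),
          f (σ.cycleLength x) := by
      refine Finset.sum_congr rfl fun x hx => ?_
      simp only [Finset.mem_filter, Finset.mem_univ, true_and] at hx
      rw [cycleLength_swap_mul_of_not_sameCycle hx.1 hx.2]
    have hconst : ∀ (c : V) (g : V → ℕ) (k : ℕ), (∀ x, σ.SameCycle c x → g x = k) →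
        ∑ x ∈ Finset.univ.filter (fun x => σ.SameCycle c x), g x = σ.cycleLength c * k := by
      intro c g k h
      rw [Finset.sum_congr rfl (g := fun _ => k) (by simpa using h), Finset.sum_const,
        card_sameCycle, smul_eq_mul]
    rw [hrest, hconst a _ (f (σ.cycleLength a + σ.cycleLength b)),
      hconst b _ (f (σ.cycleLength a + σ.cycleLength b)), hconst a _ (f (σ.cycleLength a)),
      hconst b _ (f (σ.cycleLength b))]
    · simp only [Multiset.insert_eq_cons, Multiset.map_cons, Multiset.map_singleton,
        Multiset.sum_cons, Multiset.sum_singleton, smul_eq_mul]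
      ring
    · intro x hx; rw [hx.cycleLength_eq]
    · intro x hx; rw [hx.cycleLength_eq]
    · intro x hx
      rw [(sameCycle_swap_mul_right hab hx).cycleLength_eq, cycleLength_swap_mul hab]
    · intro x hx
      rw [(sameCycle_swap_mul_left hab hx).cycleLength_eq, cycleLength_swap_mul hab]

end Merge

section Split

variable (σ : Perm V) (a : V) {j : ℕ} (h0 : 0 < j) (hj : j < σ.cycleLength a)

include h0 hj

theorem avoid_of_lt_cycleLength :
    ∀ i, 0 < i → i < j → (σ ^ i) a ≠ a ∧ (σ ^ i) a ≠ (σ ^ j) a := by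
  intro i hi hij
  refine ⟨pow_ne_of_lt_cycleLength hi (hij.trans hj), fun h => hij.ne ?_⟩
  exact pow_injOn_cycleLength σ a (hij.trans hj) hj h

theorem cycleLength_swap_pow_mul_left :
    (swap a ((σ ^ j) a) * σ).cycleLength a = j := by
  have havoid := avoid_of_lt_cycleLength σ a h0 hj
  refine Equiv.Perm.cycleLength_eq h0 ?_ ?_
  · rw [swap_mul_pow_succ_apply h0 havoid, swap_apply_right]
  · intro i hi hij
    rw [swap_mul_pow_apply havoid i hij]
    exact (havoid i hi hij).1

theorem not_sameCycle_swap_pow_mul :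
    ¬ (swap a ((σ ^ j) a) * σ).SameCycle a ((σ ^ j) a) := by
  intro h
  obtain ⟨i, hi, hia⟩ := h.exists_lt_cycleLength
  rw [cycleLength_swap_pow_mul_left σ a h0 hj] at hi
  rw [swap_mul_pow_apply (avoid_of_lt_cycleLength σ a h0 hj) i hi] at hia
  exact hi.ne (pow_injOn_cycleLength σ a (hi.trans hj) hj hia)

theorem cycleLength_swap_pow_mul_right :
    (swap a ((σ ^ j) a) * σ).cycleLength ((σ ^ j) a) = σ.cycleLength a - j := by
  have h := cycleLength_swap_mul (not_sameCycle_swap_pow_mul σ a h0 hj)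
  rw [swap_mul_self_mul, cycleLength_swap_pow_mul_left σ a h0 hj] at h
  omega

theorem cycleLengths_swap_pow_mul :
    (swap a ((σ ^ j) a) * σ).cycleLengths + {σ.cycleLength a} =
      σ.cycleLengths + {j, σ.cycleLength a - j} := by
  have h := cycleLengths_swap_mul (not_sameCycle_swap_pow_mul σ a h0 hj)
  rw [swap_mul_self_mul, cycleLength_swap_pow_mul_left σ a h0 hj,
    cycleLength_swap_pow_mul_right σ a h0 hj, Nat.add_sub_cancel' hj.le] at h
  exact h.symm

end Split

theorem cycleLength_permCongr (e : V ≃ W) (σ : Perm V) (x : V) :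
    (e.permCongr σ).cycleLength (e x) = σ.cycleLength x := by
  have hpow : ∀ i, ((e.permCongr σ) ^ i) (e x) = e ((σ ^ i) x) := by
    intro i
    induction i with
    | zero => rfl
    | succ i ih => rw [pow_succ', mul_apply, ih, pow_succ', mul_apply, permCongr_apply,
        symm_apply_apply]
  refine Equiv.Perm.cycleLength_eq (cycleLength_pos σ x) ?_ fun i h0 hi => ?_
  · rw [hpow, pow_cycleLength]
  · rw [hpow]
    exact fun h => pow_ne_of_lt_cycleLength h0 hi (e.injective h)

theorem cycleLengths_permCongr (e : V ≃ W) (σ : Perm V) :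
    (e.permCongr σ).cycleLengths = σ.cycleLengths := by
  refine Multiset.eq_of_sum_map_mul_eq (fun _ => pos_of_mem_cycleLengths)
    (fun _ => pos_of_mem_cycleLengths) fun f => ?_
  rw [← sum_cycleLength, ← sum_cycleLength, ← e.sum_comp]
  exact Finset.sum_congr rfl fun x _ => by rw [cycleLength_permCongr]

theorem cycleCount_permCongr (e : V ≃ W) (σ : Perm V) :
    (e.permCongr σ).cycleCount = σ.cycleCount := by
  rw [cycleCount, cycleLengths_permCongr, cycleCount]

theorem cycleLength_optionCongr_some (σ : Perm V) (x : V) :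
    Perm.cycleLength (optionCongr σ : Perm (Option V)) (some x) = σ.cycleLength x := by
  have hpow : ∀ i, ((optionCongr σ : Perm (Option V)) ^ i) (some x) = some ((σ ^ i) x) := by
    intro i
    induction i with
    | zero => rfl
    | succ i ih => rw [pow_succ', mul_apply, ih, pow_succ', mul_apply]; rfl
  refine Equiv.Perm.cycleLength_eq (cycleLength_pos σ x) ?_ fun i h0 hi => ?_
  · rw [hpow, pow_cycleLength]
  · rw [hpow]
    exact fun h => pow_ne_of_lt_cycleLength h0 hi (Option.some_injective _ h)

theorem cycleLength_eq_one {σ : Perm V} {x : V} (h : σ x = x) : σ.cycleLength x = 1 :=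
  Equiv.Perm.cycleLength_eq one_pos (by simpa using h) (by intro i; omega)

theorem apply_eq_of_cycleLength_eq_one {σ : Perm V} {x : V} (h : σ.cycleLength x = 1) :
    σ x = x := by
  simpa [h] using pow_cycleLength σ x

theorem cycleLength_optionCongr_none (σ : Perm V) :
    Perm.cycleLength (optionCongr σ : Perm (Option V)) none = 1 :=
  cycleLength_eq_one rfl

theorem cycleLengths_optionCongr (σ : Perm V) :
    Perm.cycleLengths (optionCongr σ : Perm (Option V)) = 1 ::ₘ σ.cycleLengths := by
  refine Multiset.eq_of_sum_map_mul_eq (fun _ => pos_of_mem_cycleLengths) ?_ fun f => ?_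
  · intro r hr
    rcases Multiset.mem_cons.1 hr with rfl | hr
    · exact one_pos
    · exact pos_of_mem_cycleLengths hr
  · rw [Multiset.map_cons, Multiset.sum_cons, ← sum_cycleLength, ← sum_cycleLength,
      Fintype.sum_option, cycleLength_optionCongr_none, one_smul]
    simp only [cycleLength_optionCongr_some]

theorem not_sameCycle_none_some (σ : Perm V) (a : V) :
    ¬ SameCycle (optionCongr σ : Perm (Option V)) none (some a) := by
  intro h
  exact Option.some_ne_none a (h.eq_of_left (show optionCongr σ none = none from rfl)).symm

theorem cycleLengths_swap_none_mul (σ : Perm V) (a : V) :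
    (swap none (some a) * optionCongr σ).cycleLengths + {σ.cycleLength a} =
      σ.cycleLengths + {σ.cycleLength a + 1} := by
  have h := cycleLengths_swap_mul (not_sameCycle_none_some σ a)
  rw [cycleLength_optionCongr_none, cycleLength_optionCongr_some, cycleLengths_optionCongr,
    Multiset.insert_eq_cons, Multiset.add_cons, Multiset.cons_add, add_comm 1] at h
  exact (Multiset.cons_inj_right 1).1 h

theorem cycleLength_swap_none_mul (σ : Perm V) (a : V) :
    (swap none (some a) * optionCongr σ).cycleLength none = σ.cycleLength a + 1 := by
  rw [cycleLength_swap_mul (not_sameCycle_none_some σ a), cycleLength_optionCongr_none,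
    cycleLength_optionCongr_some, add_comm]

theorem cycleCount_optionCongr (σ : Perm V) :
    cycleCount (optionCongr σ : Perm (Option V)) = σ.cycleCount + 1 := by
  rw [cycleCount, cycleLengths_optionCongr, Multiset.card_cons, cycleCount]

theorem cycleCount_swap_none_mul (σ : Perm V) (a : V) :
    (swap none (some a) * optionCongr σ).cycleCount = σ.cycleCount := by
  have h := congrArg Multiset.card (cycleLengths_swap_none_mul σ a)
  simpa [cycleCount] using h

theorem optionCongr_mul (σ τ : Perm V) :
    (optionCongr (σ * τ) : Perm (Option V)) = optionCongr σ * optionCongr τ := by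
  ext1 x
  cases x <;> rfl

theorem optionCongr_mul_swap_none (σ : Perm V) (b : V) :
    (optionCongr σ : Perm (Option V)) * swap none (some b) =
      swap none (some (σ b)) * optionCongr σ := by
  rw [mul_swap_eq_swap_mul]
  rfl

theorem swap_none_mul_swap_none {a b : V} (h : b ≠ a) :
    (swap none (some b) * swap none (some a) : Perm (Option V)) =
      swap none (some a) * optionCongr (swap a b) := by
  rw [optionCongr_swap, mul_swap_eq_swap_mul (swap none (some a)) (some a) (some b),
    swap_apply_right, swap_apply_of_ne_of_ne (by simp) (by simpa using h)]

/-- Every permutation of `Option V` is uniquely `optionCongr σ * swap none i`. -/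
theorem sum_perm_option {M : Type*} [AddCommMonoid M] (f : Perm (Option V) → M) :
    ∑ σ, f σ = ∑ σ : Perm V, f (optionCongr σ) +
      ∑ b : V, ∑ σ : Perm V, f (optionCongr σ * swap none (some b)) := by
  rw [← Equiv.sum_comp (Equiv.inv (Perm (Option V))),
    ← Equiv.sum_comp (decomposeOption (α := V)).symm, Fintype.sum_prod_type, Fintype.sum_option]
  have h : ∀ i : Option V, ∑ σ : Perm V, f (Equiv.inv (Perm (Option V)) (decomposeOption.symm (i, σ)))
      = ∑ σ : Perm V, f (optionCongr σ * swap none i) := by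
    intro i
    rw [← Equiv.sum_comp (Equiv.inv (Perm V))]
    refine Finset.sum_congr rfl fun σ _ => ?_
    congr 1
  rw [h none]
  simp only [h, swap_self]
  rfl

theorem cycleCount_swap_mul_swap_mul {a b : V} (h : b ≠ a) (σ τ : Perm V) :
    cycleCount (optionCongr σ * swap none (some b) * (swap none (some a) * optionCongr τ) : Perm (Option V)) =
      (σ * (swap a b * τ)).cycleCount := by
  rw [mul_assoc, ← mul_assoc (swap none (some b)), swap_none_mul_swap_none h, mul_assoc,
    ← mul_assoc, optionCongr_mul_swap_none, mul_assoc, ← optionCongr_mul, ← optionCongr_mul,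
    cycleCount_swap_none_mul]

theorem cycleCount_swap_mul_swap_mul_self (a : V) (σ τ : Perm V) :
    cycleCount (optionCongr σ * swap none (some a) * (swap none (some a) * optionCongr τ) : Perm (Option V)) =
      (σ * τ).cycleCount + 1 := by
  rw [mul_assoc, swap_mul_self_mul, ← optionCongr_mul, cycleCount_optionCongr]

theorem cycleCount_swap_mul_optionCongr (b : V) (σ τ : Perm V) :
    cycleCount (optionCongr σ * swap none (some b) * optionCongr τ : Perm (Option V)) = (σ * τ).cycleCount := by
  rw [optionCongr_mul_swap_none, mul_assoc, ← optionCongr_mul, cycleCount_swap_none_mul]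

theorem cycleCount_mul_swap_none (b : V) (σ : Perm V) :
    cycleCount (optionCongr σ * swap none (some b) : Perm (Option V)) = σ.cycleCount := by
  rw [optionCongr_mul_swap_none, cycleCount_swap_none_mul]

theorem cycleCount_pos [Nonempty V] (σ : Perm V) : 0 < σ.cycleCount := by
  obtain ⟨a⟩ := ‹Nonempty V›
  exact Multiset.card_pos_iff_exists_mem.2 ⟨_, cycleLength_mem σ a⟩

/-- Every permutation of `Option V` fixes `none` or is obtained from a permutation of `V` by
inserting `none` into a cycle. -/
theorem exists_eq_optionCongr (σ : Perm (Option V)) :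
    (∃ τ : Perm V, σ = optionCongr τ) ∨
      ∃ (a : V) (τ : Perm V), σ = swap none (some a) * optionCongr τ := by
  obtain ⟨⟨i, τ⟩, rfl⟩ := (decomposeOption (α := V)).symm.surjective σ
  rw [decomposeOption_symm_apply]
  cases i with
  | none => exact Or.inl ⟨τ, by rw [swap_self]; rfl⟩
  | some a => exact Or.inr ⟨a, τ, rfl⟩

open Polynomial in
/-- The generating function of the number of cycles of `c * τ`, as `c` runs over all full
cycles. -/
noncomputable def fullCycleSum (τ : Perm V) : ℚ[X] :=
  ∑ c : Perm V, if c.cycleCount = 1 then X ^ (c * τ).cycleCount else 0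

open Polynomial in
theorem fullCycleSum_option [Nonempty V] (τ : Perm (Option V)) :
    τ.fullCycleSum = ∑ b : V, ∑ c : Perm V, if c.cycleCount = 1 then
      X ^ cycleCount (optionCongr c * swap none (some b) * τ : Perm (Option V)) else 0 := by
  have h : ∑ c : Perm V, (if cycleCount (optionCongr c : Perm (Option V)) = 1 then
      (X : ℚ[X]) ^ cycleCount (optionCongr c * τ : Perm (Option V)) else 0) = 0 :=
    Finset.sum_eq_zero fun c _ => by
      have := cycleCount_pos c
      rw [cycleCount_optionCongr, if_neg (by omega)]
  rw [fullCycleSum, sum_perm_option, h, zero_add]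
  simp only [cycleCount_mul_swap_none]

open Polynomial in
theorem fullCycleSum_optionCongr [Nonempty V] (τ : Perm V) :
    fullCycleSum (optionCongr τ : Perm (Option V)) = Fintype.card V • τ.fullCycleSum := by
  rw [fullCycleSum_option]
  simp only [cycleCount_swap_mul_optionCongr]
  rw [Finset.sum_const, Finset.card_univ, fullCycleSum]

open Polynomial in
theorem fullCycleSum_swap_none_mul [Nonempty V] (a : V) (τ : Perm V) :
    fullCycleSum (swap none (some a) * optionCongr τ) =
      X * τ.fullCycleSum + ∑ b ∈ Finset.univ.erase a, (swap a b * τ).fullCycleSum := by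
  rw [fullCycleSum_option, ← Finset.add_sum_erase _ _ (Finset.mem_univ a)]
  congr 1
  · simp only [cycleCount_swap_mul_swap_mul_self, fullCycleSum, Finset.mul_sum, mul_ite, mul_zero,
      pow_succ']
  · refine Finset.sum_congr rfl fun b hb => ?_
    simp only [cycleCount_swap_mul_swap_mul (Finset.ne_of_mem_erase hb), fullCycleSum]

theorem card_fullCycles_option [Nonempty V] :
    (Finset.univ.filter fun c : Perm (Option V) => c.cycleCount = 1).card =
      Fintype.card V * (Finset.univ.filter fun c : Perm V => c.cycleCount = 1).card := by
  rw [Finset.card_filter, Finset.card_filter, sum_perm_option]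
  have h : ∑ c : Perm V, (if cycleCount (optionCongr c : Perm (Option V)) = 1 then 1 else 0) = 0 :=
    Finset.sum_eq_zero fun c _ => by
      have := cycleCount_pos c
      rw [cycleCount_optionCongr, if_neg (by omega)]
  rw [h, zero_add]
  simp only [cycleCount_mul_swap_none]
  rw [Finset.sum_const, Finset.card_univ, smul_eq_mul]

theorem fullCycleSum_permCongr (e : V ≃ W) (τ : Perm V) :
    (e.permCongr τ).fullCycleSum = τ.fullCycleSum := by
  rw [fullCycleSum, ← Equiv.sum_comp e.permCongr, fullCycleSum]
  simp only [cycleCount_permCongr]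
  refine Finset.sum_congr rfl fun c _ => ?_
  have : e.permCongr c * e.permCongr τ = e.permCongr (c * τ) := by
    ext x; simp
  rw [this, cycleCount_permCongr]

theorem card_fullCycles_congr (e : V ≃ W) :
    (Finset.univ.filter fun c : Perm W => c.cycleCount = 1).card =
      (Finset.univ.filter fun c : Perm V => c.cycleCount = 1).card := by
  rw [Finset.card_filter, Finset.card_filter, ← Equiv.sum_comp e.permCongr]
  simp only [cycleCount_permCongr]

theorem cycleLengths_of_subsingleton [Unique V] (σ : Perm V) : σ.cycleLengths = {1} := by
  have h := cycleLength_mem σ default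
  rw [cycleLength_eq_one (Subsingleton.elim _ _)] at h
  obtain ⟨s, hs⟩ := Multiset.exists_cons_of_mem h
  have hsum := sum_cycleLengths σ
  rw [hs, Multiset.sum_cons, Fintype.card_unique] at hsum
  have hs0 : s = 0 := Multiset.eq_zero_of_forall_notMem fun r hr => by
    have h1 := Multiset.single_le_sum (fun _ _ => Nat.zero_le _) r hr
    have h2 := pos_of_mem_cycleLengths (hs ▸ Multiset.mem_cons_of_mem hr)
    omega
  rw [hs, hs0]
  rfl

theorem cycleCount_of_subsingleton [Unique V] (σ : Perm V) : σ.cycleCount = 1 := by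
  rw [cycleCount, cycleLengths_of_subsingleton, Multiset.card_singleton]

theorem card_fullCycles (n : ℕ) :
    (Finset.univ.filter fun c : Perm (Fin (n + 1)) => c.cycleCount = 1).card = n.factorial := by
  induction n with
  | zero => simp [cycleCount_of_subsingleton (V := Fin 1)]
  | succ n ih =>
    rw [card_fullCycles_congr (finSuccEquiv (n + 1)).symm, card_fullCycles_option, ih,
      Fintype.card_fin, Nat.factorial_succ]

end Equiv.Perm

section BinomialOperator

open Polynomial

theorem binomPoly_natCast (c : ℤ) (k : ℕ) :
    binomPoly c k = ((k.factorial : ℚ))⁻¹ • (descPochhammer ℚ k).comp (X + C (c : ℚ)) := by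
  simp [binomPoly]

theorem binomPoly_absorb (c : ℤ) (k : ℕ) :
    (X + C ((c : ℚ) + 1 - k)) * binomPoly (c + 1) k = (X + C ((c : ℚ) + 1)) * binomPoly c k := by
  have hl := congrArg (fun q => q.comp (X + C ((c : ℚ) + 1))) (descPochhammer_succ_left ℚ k)
  have hr := congrArg (fun q => q.comp (X + C ((c : ℚ) + 1))) (descPochhammer_succ_right ℚ k)
  have h : (X + C ((c : ℚ) + 1) - 1 : ℚ[X]) = X + C (c : ℚ) := by
    rw [C_add, C_1]; ring
  simp only [mul_comp, X_comp, comp_assoc, sub_comp, one_comp, natCast_comp] at hl hr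
  rw [h] at hl
  have key := hr.symm.trans hl
  rw [binomPoly_natCast, binomPoly_natCast, mul_smul_comm, mul_smul_comm]
  congr 1
  push_cast
  rw [← key, C_sub, C_eq_natCast]
  ring

theorem binomPoly_succ (c : ℤ) (k : ℕ) :
    binomPoly (c + 1) (k + 1 : ℕ) = binomPoly c k + binomPoly c (k + 1 : ℕ) := by
  have hl := congrArg (fun q => q.comp (X + C ((c : ℚ) + 1))) (descPochhammer_succ_left ℚ k)
  have hr := congrArg (fun q => q.comp (X + C (c : ℚ))) (descPochhammer_succ_right ℚ k)
  have h : (X + C ((c : ℚ) + 1) - 1 : ℚ[X]) = X + C (c : ℚ) := by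
    rw [C_add, C_1]; ring
  simp only [mul_comp, X_comp, comp_assoc, sub_comp, one_comp, natCast_comp] at hl hr
  rw [h] at hl
  simp only [binomPoly_natCast]
  push_cast
  rw [hl, hr, Nat.factorial_succ]
  have hk : ((k : ℚ) + 1) ≠ 0 := by positivity
  have hf : (k.factorial : ℚ) ≠ 0 := by positivity
  simp only [smul_eq_C_mul]
  have hC : (C ((k.factorial : ℚ)⁻¹) : ℚ[X]) =
      C ((((k + 1) * k.factorial : ℕ) : ℚ)⁻¹) * ((k : ℚ[X]) + 1) := by
    rw [← C_eq_natCast, ← C_1, ← C_add, ← C_mul]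
    congr 1
    push_cast
    field_simp
  rw [hC, C_add, C_1]
  ring

/-- The linear operator sending `u ^ j` to `binom (x + c + j, k)`. -/
noncomputable def binomOp (c : ℤ) (k : ℕ) : ℚ[X] →ₗ[ℚ] ℚ[X] :=
  lsum fun j => LinearMap.toSpanSingleton ℚ ℚ[X] (binomPoly (c + j) k)

theorem binomOp_X_pow (c : ℤ) (k j : ℕ) : binomOp c k (X ^ j) = binomPoly (c + j) k := by
  simp [binomOp, lsum_apply, X_pow_eq_monomial]

theorem binomOp_ext {A B : ℚ[X] →ₗ[ℚ] ℚ[X]} (h : ∀ j : ℕ, A (X ^ j) = B (X ^ j)) (f : ℚ[X]) :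
    A f = B f := by
  induction f using Polynomial.induction_on' with
  | add p q hp hq => rw [map_add, map_add, hp, hq]
  | monomial n a => rw [← C_mul_X_pow_eq_monomial, ← smul_eq_C_mul, map_smul, map_smul, h]

theorem binomOp_X_mul (c : ℤ) (k : ℕ) (f : ℚ[X]) :
    binomOp c k (X * f) = binomOp (c + 1) k f := by
  refine binomOp_ext (A := binomOp c k ∘ₗ LinearMap.mulLeft ℚ X) (fun j => ?_) f
  rw [LinearMap.comp_apply, LinearMap.mulLeft_apply, ← pow_succ', binomOp_X_pow, binomOp_X_pow]
  push_cast
  ring_nf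

theorem binomOp_X_sub_one_mul (c : ℤ) (k : ℕ) (f : ℚ[X]) :
    binomOp c (k + 1) ((X - 1) * f) = binomOp c k f := by
  have key := binomOp_ext (A := binomOp c (k + 1) ∘ₗ LinearMap.mulLeft ℚ (X - 1))
    (B := binomOp c k) (fun j => ?_) f
  · rwa [LinearMap.comp_apply, LinearMap.mulLeft_apply] at key
  rw [LinearMap.comp_apply, LinearMap.mulLeft_apply, sub_mul, one_mul, map_sub, ← pow_succ',
    binomOp_X_pow, binomOp_X_pow, binomOp_X_pow]
  have h := binomPoly_succ (c + j) k
  rw [show c + ((j + 1 : ℕ) : ℤ) = c + j + 1 by push_cast; ring, h]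
  ring

/-- Multiplication by `x` as a first-order differential operator in `u`. -/
theorem X_mul_binomOp (c : ℤ) (k : ℕ) (f : ℚ[X]) :
    X * binomOp c k ((X - 1) * f) =
      binomOp c k ((1 - X) * (X * derivative f + C ((c : ℚ) + 1) * f) + C (k : ℚ) * X * f) := by
  have key := binomOp_ext
    (A := LinearMap.mulLeft ℚ X ∘ₗ binomOp c k ∘ₗ LinearMap.mulLeft ℚ (X - 1))
    (B := binomOp c k ∘ₗ (LinearMap.mulLeft ℚ (1 - X) ∘ₗ (LinearMap.mulLeft ℚ X ∘ₗ derivative +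
      LinearMap.mulLeft ℚ (C ((c : ℚ) + 1))) + LinearMap.mulLeft ℚ (C (k : ℚ) * X)))
    (fun j => ?_) f
  · simpa only [LinearMap.comp_apply, LinearMap.mulLeft_apply, LinearMap.add_apply] using key
  simp only [LinearMap.comp_apply, LinearMap.mulLeft_apply, LinearMap.add_apply]
  have hder : X * derivative (X ^ j : ℚ[X]) = C (j : ℚ) * X ^ j := by
    rcases j with _ | j
    · simp
    · rw [derivative_X_pow, Nat.add_sub_cancel]; ring
  have hleft : ((X - 1) * X ^ j : ℚ[X]) = X ^ (j + 1) - X ^ j := by ring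
  have hright : (1 - X) * (X * derivative (X ^ j) + C ((c : ℚ) + 1) * X ^ j)
      + C (k : ℚ) * X * X ^ j =
      ((c : ℚ) + j + 1) • X ^ j - ((c : ℚ) + j + 1 - k) • (X : ℚ[X]) ^ (j + 1) := by
    rw [hder]
    simp only [smul_eq_C_mul, C_add, C_sub, C_1]
    ring
  rw [hleft, hright, map_sub, map_sub, map_smul, map_smul, binomOp_X_pow, binomOp_X_pow]
  have h := binomPoly_absorb (c + j) k
  rw [show c + ((j + 1 : ℕ) : ℤ) = c + j + 1 by push_cast; ring]
  simp only [smul_eq_C_mul]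
  push_cast at h
  simp only [C_add, C_sub, C_1] at h ⊢
  linear_combination h

end BinomialOperator

section CyclePoly

open Polynomial

/-- The product of `u ^ r - 1` over a multiset of natural numbers `r`. -/
noncomputable def cyclePoly (s : Multiset ℕ) : ℚ[X] := (s.map fun r => X ^ r - 1).prod

theorem cyclePoly_add (s t : Multiset ℕ) : cyclePoly (s + t) = cyclePoly s * cyclePoly t := by
  simp [cyclePoly]

theorem cyclePoly_cons (r : ℕ) (s : Multiset ℕ) :
    cyclePoly (r ::ₘ s) = (X ^ r - 1) * cyclePoly s := by
  simp [cyclePoly]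

theorem cyclePoly_singleton (r : ℕ) : cyclePoly {r} = X ^ r - 1 := by
  simp [cyclePoly]

theorem cyclePoly_pair (r s : ℕ) : cyclePoly {r, s} = (X ^ r - 1) * (X ^ s - 1) := by
  simp [cyclePoly]

theorem cyclePoly_replicate (n r : ℕ) : cyclePoly (Multiset.replicate n r) = (X ^ r - 1) ^ n := by
  simp [cyclePoly]

theorem cyclePoly_erase {r : ℕ} {s : Multiset ℕ} (h : r ∈ s) :
    (X ^ r - 1) * cyclePoly (s.erase r) = cyclePoly s := by
  rw [← cyclePoly_cons, Multiset.cons_erase h]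

theorem X_pow_sub_one_ne_zero {r : ℕ} (hr : 0 < r) : (X ^ r - 1 : ℚ[X]) ≠ 0 :=
  (monic_X_pow_sub_C (1 : ℚ) hr.ne').ne_zero

theorem X_mul_derivative_cyclePoly (s : Multiset ℕ) :
    X * derivative (cyclePoly s) =
      (s.map fun r => r • (X ^ r * cyclePoly (s.erase r))).sum := by
  rw [cyclePoly, derivative_prod, ← Multiset.sum_map_mul_left]
  congr 1
  refine Multiset.map_congr rfl fun r _ => ?_
  rw [derivative_sub, derivative_one, sub_zero, derivative_X_pow, cyclePoly, nsmul_eq_mul]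
  rcases r with _ | r
  · simp
  · rw [Nat.add_sub_cancel, pow_succ, ← C_eq_natCast]; push_cast; ring

end CyclePoly

namespace Equiv.Perm

open Polynomial

variable {V : Type} [Fintype V] [DecidableEq V]

theorem cyclePoly_swap_mul_of_not_sameCycle {σ : Perm V} {a b : V} (hab : ¬σ.SameCycle a b) :
    cyclePoly (swap a b * σ).cycleLengths =
      cyclePoly σ.cycleLengths + cyclePoly (σ.cycleLengths.erase (σ.cycleLength a)) +
        cyclePoly (σ.cycleLengths.erase (σ.cycleLength b)) := by
  have h := congrArg cyclePoly (cycleLengths_swap_mul hab)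
  rw [cyclePoly_add, cyclePoly_add, cyclePoly_pair, cyclePoly_singleton] at h
  have ha := cyclePoly_erase (cycleLength_mem σ a)
  have hb := cyclePoly_erase (cycleLength_mem σ b)
  refine mul_right_cancel₀ (mul_ne_zero (X_pow_sub_one_ne_zero (cycleLength_pos σ a))
    (X_pow_sub_one_ne_zero (cycleLength_pos σ b))) (h.trans ?_)
  linear_combination (1 - X ^ σ.cycleLength b) * ha + (1 - X ^ σ.cycleLength a) * hb

theorem cyclePoly_swap_pow_mul {σ : Perm V} {a : V} {j : ℕ} (h0 : 0 < j)
    (hj : j < σ.cycleLength a) :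
    cyclePoly (swap a ((σ ^ j) a) * σ).cycleLengths =
      (X ^ j - 1) * (X ^ (σ.cycleLength a - j) - 1) *
        cyclePoly (σ.cycleLengths.erase (σ.cycleLength a)) := by
  have h := congrArg cyclePoly (cycleLengths_swap_pow_mul σ a h0 hj)
  rw [cyclePoly_add, cyclePoly_add, cyclePoly_pair, cyclePoly_singleton] at h
  have ha := cyclePoly_erase (cycleLength_mem σ a)
  refine mul_right_cancel₀ (X_pow_sub_one_ne_zero (cycleLength_pos σ a)) (h.trans ?_)
  rw [← ha]
  ring

theorem sum_cyclePoly_add_cyclePoly_erase (σ : Perm V) :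
    ∑ b, (cyclePoly σ.cycleLengths + cyclePoly (σ.cycleLengths.erase (σ.cycleLength b))) =
      X * derivative (cyclePoly σ.cycleLengths) := by
  rw [X_mul_derivative_cyclePoly,
    ← sum_cycleLength σ fun r => X ^ r * cyclePoly (σ.cycleLengths.erase r)]
  refine Finset.sum_congr rfl fun b _ => ?_
  rw [← cyclePoly_erase (cycleLength_mem σ b)]
  ring

theorem sum_cyclePoly_swap_mul (σ : Perm V) (a : V) :
    (X - 1) * ∑ b ∈ Finset.univ.erase a, cyclePoly (swap a b * σ).cycleLengths =
      (X - 1) * ((Fintype.card V : ℚ[X]) * cyclePoly (σ.cycleLengths.erase (σ.cycleLength a)) +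
        X * derivative (cyclePoly σ.cycleLengths)) - (X + 1) * cyclePoly σ.cycleLengths := by
  set W := cyclePoly σ.cycleLengths with hW
  set U : V → ℚ[X] := fun b => cyclePoly (σ.cycleLengths.erase (σ.cycleLength b)) with hU
  have hUa : (X ^ σ.cycleLength a - 1) * U a = W := cyclePoly_erase (cycleLength_mem σ a)
  have hsum : ∑ b, (W + U b) = X * derivative W := sum_cyclePoly_add_cyclePoly_erase σ
  have hdiff : ∑ b, (cyclePoly (swap a b * σ).cycleLengths - (W + U a + U b)) =
      -2 * (∑ i ∈ Finset.range (σ.cycleLength a), X ^ i) * U a := by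
    rw [← Finset.sum_filter_add_sum_filter_not _ (fun b => σ.SameCycle a b),
      Finset.sum_eq_zero (s := Finset.univ.filter fun b => ¬σ.SameCycle a b) fun b hb => ?_,
      add_zero, sum_sameCycle]
    · obtain ⟨r, hr⟩ : ∃ r, σ.cycleLength a = r + 1 :=
        ⟨_, (Nat.succ_pred_eq_of_pos (cycleLength_pos σ a)).symm⟩
      have hrefl := Finset.sum_range_reflect (fun i : ℕ => (X : ℚ[X]) ^ (i + 1)) r
      have hterm : ∀ i ∈ Finset.range r,
          cyclePoly (swap a ((σ ^ (i + 1)) a) * σ).cycleLengths - (W + U a + U ((σ ^ (i + 1)) a)) =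
            -((X ^ (i + 1) + X ^ (r - 1 - i + 1)) * U a) := by
        intro i hi
        have hi := Finset.mem_range.1 hi
        have hUi : U ((σ ^ (i + 1)) a) = U a := by
          simp only [hU]
          rw [(sameCycle_pow_apply σ a (i + 1)).symm.cycleLength_eq]
        have hsw : cyclePoly (swap a ((σ ^ (i + 1)) a) * σ).cycleLengths =
            (X ^ (i + 1) - 1) * (X ^ (σ.cycleLength a - (i + 1)) - 1) * U a :=
          cyclePoly_swap_pow_mul i.succ_pos (by omega)
        rw [hsw, hUi, ← hUa, hr, show r + 1 - (i + 1) = r - 1 - i + 1 by omega,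
          show r + 1 = (i + 1) + (r - 1 - i + 1) by omega, pow_add]
        ring
      rw [hr, Finset.sum_range_succ', Finset.sum_congr rfl hterm, Finset.sum_range_succ',
        Finset.sum_neg_distrib, ← Finset.sum_mul, Finset.sum_add_distrib, hrefl]
      simp only [pow_zero, one_apply, swap_self]
      rw [show (Equiv.refl V * σ : Perm V) = σ from rfl]
      rw [← hW]
      ring
    · rw [cyclePoly_swap_mul_of_not_sameCycle (Finset.mem_filter.1 hb).2]
      simp only [hU, hW]
      ring
  have hself : cyclePoly (swap a a * σ).cycleLengths = W := by
    rw [swap_self]; rfl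
  rw [Finset.sum_sub_distrib, ← Finset.add_sum_erase _ _ (Finset.mem_univ a), hself] at hdiff
  have hsplit : ∑ b, (W + U a + U b) = (Fintype.card V : ℚ[X]) * U a + X * derivative W := by
    rw [← hsum, ← nsmul_eq_mul, ← Finset.card_univ, ← Finset.sum_const, ← Finset.sum_add_distrib]
    exact Finset.sum_congr rfl fun b _ => by ring
  rw [hsplit] at hdiff
  have hgeom := mul_geom_sum (X : ℚ[X]) (σ.cycleLength a)
  linear_combination (X - 1) * hdiff - 2 * U a * hgeom - 2 * hUa

theorem cyclePoly_optionCongr (τ : Perm V) :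
    cyclePoly (cycleLengths (optionCongr τ : Perm (Option V))) =
      (X - 1) * cyclePoly τ.cycleLengths := by
  rw [cycleLengths_optionCongr, cyclePoly_cons, pow_one]

theorem cyclePoly_swap_none_mul (a : V) (τ : Perm V) :
    cyclePoly (cycleLengths (swap none (some a) * optionCongr τ : Perm (Option V))) =
      X * cyclePoly τ.cycleLengths +
        (X - 1) * cyclePoly (τ.cycleLengths.erase (τ.cycleLength a)) := by
  have h := congrArg cyclePoly (cycleLengths_swap_none_mul τ a)
  rw [cyclePoly_add, cyclePoly_add, cyclePoly_singleton, cyclePoly_singleton] at h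
  have ha := cyclePoly_erase (cycleLength_mem τ a)
  refine mul_right_cancel₀ (X_pow_sub_one_ne_zero (cycleLength_pos τ a)) (h.trans ?_)
  rw [← ha, pow_succ]
  ring

theorem fullCycleSum_eq_fin (n : ℕ) (τ : Perm (Fin (n + 1))) :
    τ.fullCycleSum = (n.factorial : ℚ) • binomOp 0 (n + 2) (cyclePoly τ.cycleLengths) := by
  induction n with
  | zero =>
    have hX : binomOp 0 2 (X - 1) = (X : ℚ[X]) := by
      have h := binomOp_X_sub_one_mul 0 1 1
      rw [mul_one] at h
      rw [h, ← pow_zero X, binomOp_X_pow, binomPoly_natCast]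
      simp
    rw [cycleLengths_of_subsingleton (V := Fin 1), cyclePoly_singleton, pow_one, hX, fullCycleSum]
    simp [cycleCount_of_subsingleton (V := Fin 1)]
  | succ n ih =>
    obtain ⟨σ, rfl⟩ := (finSuccEquiv (n + 1)).symm.permCongr.surjective τ
    rw [fullCycleSum_permCongr, cycleLengths_permCongr]
    have hL := binomOp_X_sub_one_mul 0 (n + 2)
    obtain ⟨τ, rfl⟩ | ⟨a, τ, rfl⟩ := exists_eq_optionCongr σ
    · rw [fullCycleSum_optionCongr, ih, cyclePoly_optionCongr, hL, Fintype.card_fin,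
        Nat.factorial_succ]
      push_cast
      rw [mul_smul, ← Nat.cast_smul_eq_nsmul ℚ]
      push_cast
      rfl
    · rw [fullCycleSum_swap_none_mul, cyclePoly_swap_none_mul, ih]
      simp only [ih]
      rw [← Finset.smul_sum, mul_smul_comm, ← smul_add, Nat.factorial_succ, mul_comm (n + 1),
        Nat.cast_mul, mul_smul, ← map_sum, ← hL, X_mul_binomOp, ← hL, sum_cyclePoly_swap_mul,
        ← map_add, ← map_smul, ← map_smul, ← map_smul]
      congr 1
      simp only [← C_eq_natCast, smul_eq_C_mul, Fintype.card_fin]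
      push_cast
      simp only [C_add, C_1, C_0, map_ofNat]
      ring

/-- The generating function of the number of cycles of `c * τ` over all full cycles `c`. -/
theorem fullCycleSum_eq [Nonempty V] (τ : Perm V) :
    τ.fullCycleSum = ((Fintype.card V - 1).factorial : ℚ) •
      binomOp 0 (Fintype.card V + 1) (cyclePoly τ.cycleLengths) := by
  obtain ⟨n, hn⟩ : ∃ n, Fintype.card V = n + 1 :=
    ⟨_, (Nat.succ_pred_eq_of_pos Fintype.card_pos).symm⟩
  rw [← fullCycleSum_permCongr (Fintype.equivFinOfCardEq hn),
    ← cycleLengths_permCongr (Fintype.equivFinOfCardEq hn), fullCycleSum_eq_fin, hn,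
    Nat.add_sub_cancel]

end Equiv.Perm

namespace Equiv.Perm

open Polynomial

set_option linter.unusedSectionVars false

variable {V W : Type} [Fintype V] [DecidableEq V] [Fintype W] [DecidableEq W]

/-- The generating function of the number of cycles of `c * σ`, as `c` runs over the permutations
with two cycles, one of which is the fixed point `b`. -/
noncomputable def fixSum (σ : Perm V) (b : V) : ℚ[X] :=
  ∑ c : Perm V, if c b = b ∧ c.cycleCount = 2 then X ^ (c * σ).cycleCount else 0

theorem fixSum_permCongr (e : V ≃ W) (σ : Perm V) (b : V) :
    (e.permCongr σ).fixSum (e b) = σ.fixSum b := by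
  rw [fixSum, ← Equiv.sum_comp e.permCongr, fixSum]
  simp only [cycleCount_permCongr]
  refine Finset.sum_congr rfl fun c _ => ?_
  have : e.permCongr c * e.permCongr σ = e.permCongr (c * σ) := by
    ext x; simp
  rw [this, cycleCount_permCongr]
  simp

theorem fixSum_none (σ : Perm (Option V)) :
    σ.fixSum none = ∑ c : Perm V, if c.cycleCount = 1 then
      X ^ cycleCount (optionCongr c * σ : Perm (Option V)) else 0 := by
  rw [fixSum, sum_perm_option, Finset.sum_eq_zero (s := Finset.univ (α := V)), add_zero]
  · refine Finset.sum_congr rfl fun c _ => ?_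
    rw [cycleCount_optionCongr]
    refine if_congr ?_ rfl rfl
    constructor
    · rintro ⟨-, h⟩; omega
    · intro h; exact ⟨rfl, by omega⟩
  · refine fun b _ => Finset.sum_eq_zero fun c _ => if_neg ?_
    rintro ⟨h, -⟩
    rw [mul_apply, swap_apply_left] at h
    exact Option.some_ne_none _ h

theorem fixSum_optionCongr_none (τ : Perm V) :
    fixSum (optionCongr τ : Perm (Option V)) none = X * τ.fullCycleSum := by
  rw [fixSum_none, fullCycleSum, Finset.mul_sum]
  refine Finset.sum_congr rfl fun c _ => ?_
  rw [← optionCongr_mul, cycleCount_optionCongr, mul_ite, mul_zero, pow_succ']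

theorem fixSum_swap_none_mul_none (a : V) (τ : Perm V) :
    fixSum (swap none (some a) * optionCongr τ : Perm (Option V)) none = τ.fullCycleSum := by
  rw [fixSum_none, fullCycleSum]
  refine Finset.sum_congr rfl fun c _ => ?_
  rw [← mul_assoc, cycleCount_swap_mul_optionCongr]

theorem fixSum_none_eq_of_fixed [Nonempty V] (σ : Perm (Option V)) (h : σ none = none) :
    σ.fixSum none = ((Fintype.card V - 1).factorial : ℚ) •
      (X * binomOp 0 (Fintype.card V + 1) (cyclePoly (σ.cycleLengths.erase 1))) := by
  obtain ⟨τ, rfl⟩ | ⟨a, τ, rfl⟩ := exists_eq_optionCongr σ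
  · rw [fixSum_optionCongr_none, fullCycleSum_eq, cycleLengths_optionCongr,
      Multiset.erase_cons_head, mul_smul_comm]
  · rw [mul_apply, show optionCongr τ none = none from rfl, swap_apply_left] at h
    exact absurd h (Option.some_ne_none _)

theorem fixSum_none_eq_of_not_fixed [Nonempty V] (σ : Perm (Option V)) (h : σ none ≠ none) :
    σ.fixSum none = ((Fintype.card V - 1).factorial : ℚ) •
      binomOp 0 (Fintype.card V + 1) ((X ^ (σ.cycleLength none - 1) - 1) *
        cyclePoly (σ.cycleLengths.erase (σ.cycleLength none))) := by
  obtain ⟨τ, rfl⟩ | ⟨a, τ, rfl⟩ := exists_eq_optionCongr σ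
  · exact absurd rfl h
  · have hlen := cycleLengths_swap_none_mul τ a
    rw [add_comm τ.cycleLengths, Multiset.singleton_add] at hlen
    have herase := congrArg (fun s => Multiset.erase s (τ.cycleLength a + 1)) hlen
    simp only [Multiset.erase_cons_head] at herase
    have hmem : τ.cycleLength a + 1 ∈ (swap none (some a) * optionCongr τ).cycleLengths := by
      rw [← cycleLength_swap_none_mul]
      exact cycleLength_mem _ _
    rw [Multiset.erase_add_left_pos _ hmem] at herase
    rw [fixSum_swap_none_mul_none, fullCycleSum_eq, ← herase, cyclePoly_add, cyclePoly_singleton,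
      cycleLength_swap_none_mul, Nat.add_sub_cancel, mul_comm (cyclePoly _)]

theorem fixSum_eq_of_fixed (σ : Perm V) (b : V) (h : σ b = b) {m : ℕ}
    (hm : Fintype.card V = m + 2) :
    σ.fixSum b = (m.factorial : ℚ) •
      (X * binomOp 0 (m + 2) (cyclePoly (σ.cycleLengths.erase 1))) := by
  have hcard : Fintype.card {x // x ≠ b} = m + 1 := by
    have := Fintype.card_congr (optionSubtypeNe b)
    rw [Fintype.card_option, hm] at this
    omega
  have : Nonempty {x // x ≠ b} := Fintype.card_pos_iff.1 (by omega)
  obtain ⟨σ, rfl⟩ := (optionSubtypeNe b).permCongr.surjective σ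
  have hf := fixSum_permCongr (optionSubtypeNe b) σ none
  rw [optionSubtypeNe_none] at hf
  rw [hf, cycleLengths_permCongr, fixSum_none_eq_of_fixed, hcard, Nat.add_sub_cancel]
  refine (optionSubtypeNe b).injective ?_
  simpa using h

theorem fixSum_eq_of_not_fixed (σ : Perm V) (b : V) (h : σ b ≠ b) {m : ℕ}
    (hm : Fintype.card V = m + 2) :
    σ.fixSum b = (m.factorial : ℚ) •
      binomOp 0 (m + 2) ((X ^ (σ.cycleLength b - 1) - 1) *
        cyclePoly (σ.cycleLengths.erase (σ.cycleLength b))) := by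
  have hcard : Fintype.card {x // x ≠ b} = m + 1 := by
    have := Fintype.card_congr (optionSubtypeNe b)
    rw [Fintype.card_option, hm] at this
    omega
  have : Nonempty {x // x ≠ b} := Fintype.card_pos_iff.1 (by omega)
  obtain ⟨σ, rfl⟩ := (optionSubtypeNe b).permCongr.surjective σ
  have hf := fixSum_permCongr (optionSubtypeNe b) σ none
  have hl := cycleLength_permCongr (optionSubtypeNe b) σ none
  rw [optionSubtypeNe_none] at hf hl
  rw [hf, hl, cycleLengths_permCongr, fixSum_none_eq_of_not_fixed, hcard, Nat.add_sub_cancel]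
  refine fun h' => h ?_
  simp [h']

/-- The generating function of the number of cycles of `α * ω`, as `α` runs over the products of
a transposition `swap none (some b)` and a cycle on the remaining points. -/
noncomputable def pairSum (ω : Perm (Option V)) : ℚ[X] :=
  ∑ b : V, ∑ c : Perm V, if c b = b ∧ c.cycleCount = 2 then
    X ^ cycleCount (swap none (some b) * optionCongr c * ω : Perm (Option V)) else 0

theorem pairSum_swap_none_mul (d : V) (τ : Perm V) :
    pairSum (swap none (some d) * optionCongr τ) =
      X * τ.fixSum d + ∑ b ∈ Finset.univ.erase d, (swap d b * τ).fixSum b := by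
  have hcomm : ∀ (b : V) (c : Perm V), c b = b →
      (swap none (some b) * optionCongr c : Perm (Option V)) =
        optionCongr c * swap none (some b) := by
    intro b c h
    rw [optionCongr_mul_swap_none, h]
  rw [pairSum, ← Finset.add_sum_erase _ _ (Finset.mem_univ d)]
  congr 1
  · rw [fixSum, Finset.mul_sum]
    refine Finset.sum_congr rfl fun c _ => ?_
    split_ifs with h
    · rw [hcomm d c h.1, cycleCount_swap_mul_swap_mul_self, pow_succ']
    · rw [mul_zero]
  · refine Finset.sum_congr rfl fun b hb => ?_
    rw [fixSum]
    refine Finset.sum_congr rfl fun c _ => ?_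
    split_ifs with h
    · rw [hcomm b c h.1, cycleCount_swap_mul_swap_mul (Finset.ne_of_mem_erase hb)]
    · rfl

theorem optionCongr_pow_apply_some (τ : Perm V) (i : ℕ) (x : V) :
    ((optionCongr τ : Perm (Option V)) ^ i) (some x) = some ((τ ^ i) x) := by
  induction i with
  | zero => rfl
  | succ i ih => rw [pow_succ', pow_succ', mul_apply, mul_apply, ih]; rfl

theorem sameCycle_of_optionCongr {τ : Perm V} {x y : V}
    (h : SameCycle (optionCongr τ : Perm (Option V)) (some x) (some y)) : τ.SameCycle x y := by
  obtain ⟨i, -, hi⟩ := h.exists_lt_cycleLength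
  rw [optionCongr_pow_apply_some, Option.some_inj] at hi
  exact hi ▸ sameCycle_pow_apply τ x i

theorem cycleLength_swap_none_mul_some {τ : Perm V} {d b : V} (h : ¬τ.SameCycle d b) :
    (swap none (some d) * optionCongr τ : Perm (Option V)).cycleLength (some b) =
      τ.cycleLength b := by
  rw [cycleLength_swap_mul_of_not_sameCycle (not_sameCycle_none_some τ b)
    fun h' => h (sameCycle_of_optionCongr h'), cycleLength_optionCongr_some]

/-- The value of `pairSum` on a permutation all of whose cycles have length `s + 3`. -/
theorem pairSum_eq (s n m : ℕ) (hm : Fintype.card V = m + 2) (ω : Perm (Option V))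
    (hω : ω.cycleLengths = Multiset.replicate (n + 1) (s + 3)) :
    ω.pairSum = (m.factorial : ℚ) •
      (2 * X * binomOp 0 (m + 2) ((X ^ (s + 1) - 1) * (X ^ (s + 3) - 1) ^ n) +
        ∑ i ∈ Finset.range s, binomOp 0 (m + 2)
          ((X ^ (s - i) - 1) * (X ^ (i + 1) - 1) * (X ^ (s + 3) - 1) ^ n) +
        ((s + 3) * n : ℚ) • binomOp 0 (m + 2)
          ((X ^ (2 * s + 4) - 1) * (X ^ (s + 3) - 1) ^ (n - 1))) := by
  obtain ⟨τ, rfl⟩ | ⟨d, τ, rfl⟩ := exists_eq_optionCongr ω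
  · have := Multiset.eq_of_mem_replicate (hω ▸ cycleLength_mem _ none)
    rw [cycleLength_optionCongr_none] at this
    omega
  have hr : τ.cycleLength d = s + 2 := by
    have := Multiset.eq_of_mem_replicate (hω ▸ cycleLength_mem _ none)
    rw [cycleLength_swap_none_mul] at this
    omega
  have hτ : τ.cycleLengths = {s + 2} + Multiset.replicate n (s + 3) := by
    have h := cycleLengths_swap_none_mul τ d
    rw [hω, hr, Multiset.replicate_succ, ← Multiset.singleton_add, add_comm, ← add_assoc,
      add_right_comm] at h
    exact (add_right_cancel h).symm
  have hnf : ∀ (σ : Perm V) (b : V), 1 < σ.cycleLength b → σ b ≠ b := fun σ b h h' => by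
    rw [cycleLength_eq_one h'] at h
    omega
  have hfirst : τ.fixSum d = (m.factorial : ℚ) •
      binomOp 0 (m + 2) ((X ^ (s + 1) - 1) * (X ^ (s + 3) - 1) ^ n) := by
    rw [fixSum_eq_of_not_fixed τ d (hnf τ d (by omega)) hm, hr, hτ, Multiset.singleton_add,
      Multiset.erase_cons_head, cyclePoly_replicate]
    rfl
  have hsplit : ∀ i < s + 1, (swap d ((τ ^ (i + 1)) d) * τ).cycleLengths =
      (s + 1 - i) ::ₘ (i + 1) ::ₘ Multiset.replicate n (s + 3) := by
    intro i hi
    have h := cycleLengths_swap_pow_mul τ d i.succ_pos (by omega)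
    rw [hτ, hr, add_comm, add_assoc] at h
    rw [add_left_cancel h, Multiset.pair_comm, add_comm, show s + 2 - i.succ = s + 1 - i by omega]
    rfl
  have hright : ∀ i < s + 1,
      (swap d ((τ ^ (i + 1)) d) * τ).cycleLength ((τ ^ (i + 1)) d) = s + 1 - i := by
    intro i hi
    rw [cycleLength_swap_pow_mul_right τ d i.succ_pos (by omega), hr]
    omega
  have hsame : ∀ i ∈ Finset.range s, (swap d ((τ ^ (i + 1)) d) * τ).fixSum ((τ ^ (i + 1)) d) =
      (m.factorial : ℚ) • binomOp 0 (m + 2)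
        ((X ^ (s - i) - 1) * (X ^ (i + 1) - 1) * (X ^ (s + 3) - 1) ^ n) := by
    intro i hi
    have hi := Finset.mem_range.1 hi
    have hlen := hright i (by omega)
    rw [fixSum_eq_of_not_fixed _ _ (hnf _ _ (by omega)) hm, hlen, hsplit i (by omega),
      Multiset.erase_cons_head, cyclePoly_cons, cyclePoly_replicate,
      show s + 1 - i - 1 = s - i by omega, mul_assoc]
  have hlast : (swap d ((τ ^ (s + 1)) d) * τ).fixSum ((τ ^ (s + 1)) d) =
      (m.factorial : ℚ) •
        (X * binomOp 0 (m + 2) ((X ^ (s + 1) - 1) * (X ^ (s + 3) - 1) ^ n)) := by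
    have hlen := hright s (by omega)
    rw [show s + 1 - s = 1 by omega] at hlen
    rw [fixSum_eq_of_fixed _ _ (apply_eq_of_cycleLength_eq_one hlen) hm, hsplit s (by omega),
      show s + 1 - s = 1 by omega, Multiset.erase_cons_head, cyclePoly_cons, cyclePoly_replicate]
  have hother : ∀ b ∈ Finset.univ.filter fun b => ¬τ.SameCycle d b,
      (swap d b * τ).fixSum b = (m.factorial : ℚ) • binomOp 0 (m + 2)
        ((X ^ (2 * s + 4) - 1) * (X ^ (s + 3) - 1) ^ (n - 1)) := by
    intro b hb
    have hdb := (Finset.mem_filter.1 hb).2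
    have hrb : τ.cycleLength b = s + 3 := by
      rw [← cycleLength_swap_none_mul_some hdb]
      exact Multiset.eq_of_mem_replicate (hω ▸ cycleLength_mem _ _)
    have hn : n = n - 1 + 1 := by
      rcases n with _ | n
      · have := hτ ▸ cycleLength_mem τ b
        rw [hrb] at this
        simp at this
      · rfl
    have hlen : (swap d b * τ).cycleLength b = 2 * s + 5 := by
      rw [swap_comm, cycleLength_swap_mul fun h => hdb h.symm, hr, hrb]
      omega
    have hlens : (swap d b * τ).cycleLengths =
        (2 * s + 5) ::ₘ Multiset.replicate (n - 1) (s + 3) := by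
      have h := cycleLengths_swap_mul hdb
      rw [hr, hrb, hτ, hn, Multiset.replicate_succ, show s + 2 + (s + 3) = 2 * s + 5 by omega,
        ← Multiset.singleton_add (s + 3), ← add_assoc,
        show ({s + 2} + {s + 3} : Multiset ℕ) = {s + 2, s + 3} from rfl,
        add_comm, add_assoc] at h
      rw [add_left_cancel h, add_comm]
      rfl
    rw [fixSum_eq_of_not_fixed _ _ (hnf _ _ (by omega)) hm, hlen, hlens,
      Multiset.erase_cons_head, cyclePoly_replicate]
    rfl
  have hcard : (Finset.univ.filter fun b => ¬τ.SameCycle d b).card = (s + 3) * n := by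
    have h1 := Finset.card_filter_add_card_filter_not (s := Finset.univ) fun b => τ.SameCycle d b
    have h2 := sum_cycleLengths τ
    rw [hτ, Multiset.sum_add, Multiset.sum_singleton, Multiset.sum_replicate, smul_eq_mul] at h2
    rw [card_sameCycle, hr, Finset.card_univ] at h1
    rw [mul_comm n] at h2
    omega
  have hall : ∑ b ∈ Finset.univ.erase d, (swap d b * τ).fixSum b =
      ∑ i ∈ Finset.range (s + 1), (swap d ((τ ^ (i + 1)) d) * τ).fixSum ((τ ^ (i + 1)) d) +
        ∑ b ∈ Finset.univ.filter fun b => ¬τ.SameCycle d b, (swap d b * τ).fixSum b := by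
    have h1 := Finset.add_sum_erase Finset.univ (fun b => (swap d b * τ).fixSum b)
      (Finset.mem_univ d)
    have h2 := Finset.sum_filter_add_sum_filter_not Finset.univ (fun b => τ.SameCycle d b)
      fun b => (swap d b * τ).fixSum b
    rw [sum_sameCycle, hr, Finset.sum_range_succ'] at h2
    simp only [pow_zero, one_apply] at h2
    linear_combination h1 - h2
  rw [pairSum_swap_none_mul, hall, Finset.sum_range_succ, Finset.sum_congr rfl hsame,
    Finset.sum_congr rfl hother, Finset.sum_const, hcard, hfirst, hlast, ← Finset.smul_sum,
    ← Nat.cast_smul_eq_nsmul ℚ]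
  simp only [smul_eq_C_mul]
  push_cast
  ring

end Equiv.Perm

namespace Equiv.Perm

open Polynomial

set_option linter.unusedSectionVars false

variable {V W : Type} [Fintype V] [DecidableEq V] [Fintype W] [DecidableEq W]

/-- The generating function of the number of cycles of `α * ω`, as `ω` runs over the
permutations with cycle lengths `β`. -/
noncomputable def classSum (α : Perm V) (β : Multiset ℕ) : ℚ[X] :=
  ∑ ω ∈ Finset.univ.filter (fun ω : Perm V => ω.cycleLengths = β), X ^ (α * ω).cycleCount

theorem classSum_permCongr (e : V ≃ W) (α : Perm V) (β : Multiset ℕ) :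
    (e.permCongr α).classSum β = α.classSum β := by
  rw [classSum, Finset.sum_filter, ← Equiv.sum_comp e.permCongr, classSum, Finset.sum_filter]
  simp only [cycleLengths_permCongr]
  refine Finset.sum_congr rfl fun ω _ => ?_
  have : e.permCongr α * e.permCongr ω = e.permCongr (α * ω) := by
    ext x; simp
  rw [this, cycleCount_permCongr]

theorem classSum_congr {α α' : Perm V} (h : α.cycleLengths = α'.cycleLengths) (β : Multiset ℕ) :
    α.classSum β = α'.classSum β := by
  obtain ⟨g, hg⟩ := isConj_iff.1 (partition_eq_of_isConj.2 (Nat.Partition.ext h))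
  have : α' = g.permCongr α := by
    rw [← hg]
    ext x
    simp
  rw [this, classSum_permCongr]

theorem card_cycleLengths_permCongr (e : V ≃ W) (β : Multiset ℕ) :
    (Finset.univ.filter fun ω : Perm W => ω.cycleLengths = β).card =
      (Finset.univ.filter fun ω : Perm V => ω.cycleLengths = β).card := by
  rw [Finset.card_filter, Finset.card_filter, ← Equiv.sum_comp e.permCongr]
  simp only [cycleLengths_permCongr]

theorem card_fixed_fullCycles {m : ℕ} (hm : Fintype.card V = m + 2) (b : V) :
    (Finset.univ.filter fun c : Perm V => c b = b ∧ c.cycleCount = 2).card = m.factorial := by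
  have hcard : Fintype.card {x // x ≠ b} = m + 1 := by
    have := Fintype.card_congr (optionSubtypeNe b)
    rw [Fintype.card_option, hm] at this
    omega
  have heval := congrArg (eval 1) (fixSum_permCongr (optionSubtypeNe b) 1 none)
  rw [optionSubtypeNe_none, fixSum_none, fixSum, eval_finsetSum, eval_finsetSum] at heval
  simp only [apply_ite (eval (1 : ℚ)), eval_pow, eval_X, one_pow, eval_zero] at heval
  rw [Finset.sum_boole, Finset.sum_boole, Nat.cast_inj] at heval
  rw [heval, card_fullCycles_congr (Fintype.equivFinOfCardEq hcard).symm, card_fullCycles]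

theorem cycleLengths_swap_none_mul_of_fixed {m : ℕ} (hm : Fintype.card V = m + 2) {b : V}
    {c : Perm V} (hb : c b = b) (hc : c.cycleCount = 2) :
    cycleLengths (swap none (some b) * optionCongr c : Perm (Option V)) = {2, m + 1} := by
  have hr := cycleLength_eq_one hb
  obtain ⟨t, ht⟩ := Multiset.exists_cons_of_mem (cycleLength_mem c b)
  rw [hr] at ht
  have hcard : Multiset.card t = 1 := by
    rw [cycleCount, ht, Multiset.card_cons] at hc
    omega
  obtain ⟨r, rfl⟩ := Multiset.card_eq_one.1 hcard
  have hsum := sum_cycleLengths c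
  rw [ht, hm, Multiset.sum_cons, Multiset.sum_singleton] at hsum
  obtain rfl : r = m + 1 := by omega
  have h := cycleLengths_swap_none_mul c b
  rw [hr, ht, ← Multiset.singleton_add, add_comm _ {1}, add_assoc] at h
  rw [add_left_cancel h, add_comm]
  rfl

theorem sum_pairSum {m : ℕ} (hm : Fintype.card V = m + 2) (α : Perm (Option V))
    (hα : α.cycleLengths = {2, m + 1}) (β : Multiset ℕ) :
    ∑ ω ∈ Finset.univ.filter (fun ω : Perm (Option V) => ω.cycleLengths = β), ω.pairSum =
      ((m + 2) * m.factorial : ℚ) • α.classSum β := by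
  have hswap : ∑ ω ∈ Finset.univ.filter (fun ω : Perm (Option V) => ω.cycleLengths = β),
      ω.pairSum = ∑ b : V, ∑ c : Perm V, if c b = b ∧ c.cycleCount = 2 then
        classSum (swap none (some b) * optionCongr c : Perm (Option V)) β else 0 := by
    simp only [pairSum]
    rw [Finset.sum_comm]
    refine Finset.sum_congr rfl fun b _ => ?_
    rw [Finset.sum_comm]
    refine Finset.sum_congr rfl fun c _ => ?_
    split_ifs
    · rfl
    · exact Finset.sum_const_zero
  have hterm : ∀ (b : V) (c : Perm V), (if c b = b ∧ c.cycleCount = 2 then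
        classSum (swap none (some b) * optionCongr c : Perm (Option V)) β else 0) =
      if c b = b ∧ c.cycleCount = 2 then α.classSum β else 0 := by
    intro b c
    split_ifs with h
    · exact classSum_congr ((cycleLengths_swap_none_mul_of_fixed hm h.1 h.2).trans hα.symm) β
    · rfl
  rw [hswap]
  simp only [hterm]
  simp only [← Finset.sum_filter, Finset.sum_const, card_fixed_fullCycles hm, Finset.card_univ, hm]
  rw [smul_smul, ← Nat.cast_smul_eq_nsmul ℚ]
  push_cast
  rfl

theorem smul_classSum_eq {m : ℕ} (α : Perm (Fin (m + 3))) (hα : α.cycleLengths = {2, m + 1})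
    {β : Multiset ℕ} {K : ℚ[X]}
    (hK : ∀ ω : Perm (Option (Fin (m + 2))), ω.cycleLengths = β →
      ω.pairSum = (m.factorial : ℚ) • K) :
    ((m + 2 : ℕ) : ℚ) • α.classSum β =
      ((Finset.univ.filter fun ω : Perm (Fin (m + 3)) => ω.cycleLengths = β).card : ℚ) • K := by
  obtain ⟨α, rfl⟩ := (finSuccEquiv (m + 2)).symm.permCongr.surjective α
  rw [cycleLengths_permCongr] at hα
  have h := sum_pairSum (Fintype.card_fin _) α hα β
  rw [Finset.sum_congr rfl fun ω hω => hK ω (Finset.mem_filter.1 hω).2,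
    Finset.sum_const, ← Nat.cast_smul_eq_nsmul ℚ, smul_comm, mul_comm, mul_smul] at h
  have hf : (m.factorial : ℚ) ≠ 0 := by positivity
  rw [classSum_permCongr, card_cycleLengths_permCongr (finSuccEquiv (m + 2)).symm]
  push_cast
  exact (smul_right_injective ℚ[X] hf h).symm

theorem fullCycleType_eq_cycleLengths {N : ℕ} (σ : Perm (Fin N)) :
    fullCycleType σ = σ.cycleLengths := by
  rw [fullCycleType, cycleLengths, parts_partition, sum_cycleType, Fintype.card_fin]

theorem numCycles_eq_cycleCount {N : ℕ} (σ : Perm (Fin N)) : numCycles σ = σ.cycleCount := by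
  rw [numCycles, fullCycleType_eq_cycleLengths, cycleCount]

theorem permClass_eq (N : ℕ) (β : Multiset ℕ) :
    permClass N β = Finset.univ.filter fun ω : Perm (Fin N) => ω.cycleLengths = β := by
  simp only [permClass, fullCycleType_eq_cycleLengths]

theorem permClass_nonempty {N n p : ℕ} (hN : N = n * p) (hp : 2 ≤ p) :
    (permClass N (Multiset.replicate n p)).Nonempty := by
  have hsum : (Multiset.replicate n p).sum = N := by simp [hN]
  obtain ⟨g, hg⟩ := (exists_with_cycleType_iff (Fin N) (m := Multiset.replicate n p)).2
    ⟨by rw [hsum, Fintype.card_fin], fun a ha => (Multiset.eq_of_mem_replicate ha).symm ▸ hp⟩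
  refine ⟨g, Finset.mem_filter.2 ⟨Finset.mem_univ _, ?_⟩⟩
  rw [fullCycleType, hg, hsum, Nat.sub_self, Multiset.replicate_zero, add_zero]

theorem Pperm_eq (s n m : ℕ) (hN : m + 3 = (n + 1) * (s + 3)) (α : Perm (Fin (m + 3)))
    (hα : fullCycleType α = {2, m + 1}) :
    Pperm α (Multiset.replicate (n + 1) (s + 3)) = ((m + 3 : ℕ) : ℚ) •
      (2 * X * binomOp 0 (m + 2) ((X ^ (s + 1) - 1) * (X ^ (s + 3) - 1) ^ n) +
        ∑ i ∈ Finset.range s, binomOp 0 (m + 2)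
          ((X ^ (s - i) - 1) * (X ^ (i + 1) - 1) * (X ^ (s + 3) - 1) ^ n) +
        ((s + 3) * n : ℚ) • binomOp 0 (m + 2)
          ((X ^ (2 * s + 4) - 1) * (X ^ (s + 3) - 1) ^ (n - 1))) := by
  have hcard : ((permClass (m + 3) (Multiset.replicate (n + 1) (s + 3))).card : ℚ) ≠ 0 :=
    Nat.cast_ne_zero.2 (permClass_nonempty hN (by omega)).card_pos.ne'
  rw [fullCycleType_eq_cycleLengths] at hα
  have h := smul_classSum_eq α hα fun ω => pairSum_eq s n m (Fintype.card_fin _) ω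
  rw [← permClass_eq, classSum, ← permClass_eq] at h
  rw [Pperm, ← smul_eq_C_mul]
  simp only [numCycles_eq_cycleCount]
  rw [show (((m + 3 : ℕ) : ℚ) * (((m + 3 : ℕ) : ℚ) - 1)) /
      ((permClass (m + 3) (Multiset.replicate (n + 1) (s + 3))).card : ℚ) =
    ((m + 3 : ℕ) : ℚ) * (((permClass (m + 3) (Multiset.replicate (n + 1) (s + 3))).card : ℚ)⁻¹ *
      ((m + 2 : ℕ) : ℚ)) by push_cast; ring, mul_smul, mul_smul, h, inv_smul_smul₀ hcard]

end Equiv.Perm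

section RegularType

open Polynomial

theorem binomOp_X_pow_sub_one_pow (c : ℤ) (k p n : ℕ) :
    binomOp c k ((X ^ p - 1) ^ n) = ∑ i ∈ Finset.range (n + 1),
      ((-1 : ℚ) ^ (n - i) * (n.choose i : ℚ)) • binomPoly ((p : ℤ) * i + c) k := by
  rw [sub_eq_add_neg, add_pow, map_sum]
  refine Finset.sum_congr rfl fun i _ => ?_
  rw [show ((X ^ p) ^ i * (-1) ^ (n - i) * (n.choose i : ℚ[X]) : ℚ[X]) =
      ((-1 : ℚ) ^ (n - i) * (n.choose i : ℚ)) • X ^ (p * i) by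
    rw [smul_eq_C_mul, C_mul, C_pow, C_neg, C_1, ← C_eq_natCast, ← pow_mul]; ring,
    map_smul, binomOp_X_pow, add_comm]
  push_cast
  rfl

theorem sum_X_pow_sub_one_mul (s : ℕ) :
    ∑ i ∈ Finset.range s, ((X : ℚ[X]) ^ (s - i) - 1) * (X ^ (i + 1) - 1) =
      (s : ℚ[X]) * X ^ (s + 1) + (s : ℚ[X]) - 2 * ∑ i ∈ Finset.range s, X ^ (i + 1) := by
  have hterm : ∀ i ∈ Finset.range s, ((X : ℚ[X]) ^ (s - i) - 1) * (X ^ (i + 1) - 1) =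
      (X ^ (s + 1) + 1) - (X ^ (s - 1 - i + 1) + X ^ (i + 1)) := by
    intro i hi
    have hi := Finset.mem_range.1 hi
    rw [show s - i = s - 1 - i + 1 by omega, show s + 1 = (s - 1 - i + 1) + (i + 1) by omega,
      pow_add]
    ring
  have hrefl := Finset.sum_range_reflect (fun i : ℕ => (X : ℚ[X]) ^ (i + 1)) s
  rw [Finset.sum_congr rfl hterm, Finset.sum_sub_distrib, Finset.sum_const, Finset.card_range,
    nsmul_eq_mul, Finset.sum_add_distrib, hrefl]
  ring

theorem derivative_add_one_mul_ring_identity {R : Type*} [CommRing R] {x y b g s k N : R}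
    (hN : N = (k + 2) * (s + 3)) (hb : (x - 1) * b = x ^ 2 * y - 1) :
    (1 - x) * (x * ((1 + 0) * ((x ^ 2 * y - 1) * g) +
        (x + 1) * ((k + 2) * (g * ((s + 3) * (x * y))))) - (x + 1) * ((x ^ 2 * y - 1) * g)) +
        (N - 1) * x * ((x + 1) * ((x ^ 2 * y - 1) * g)) =
      (x - 1) * ((x ^ 2 * y - 1) * g - (x + 1) * N * (x ^ 2 * y) * g +
        (N - 1) * x * (x + 1) * b * g) := by
  linear_combination (-(N - 1) * x * (x + 1) * g) * hb +
    ((x - 1) * (x + 1) * (x ^ 2 * y) * g) * hN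

theorem geom_sum_combination_ring_identity {R : Type*} [CommRing R] {x y b e g N : R}
    (hb : (x - 1) * b = x ^ 2 * y - 1) (he : (x - 1) * e = y - 1) (hbe : b = e + y + x * y) :
    (x - 1) * ((N * (x ^ 2 * y + x) - 2 * x * b) * g) + 2 * (N * (x * (x * ((y - 1) * g)))) =
      (x - 1) * ((x ^ 2 * y - 1) * g - (x + 1) * N * (x ^ 2 * y) * g +
        (N - 1) * x * (x + 1) * b * g) + (x - 1) * ((x - 1) * ((x ^ 2 * y - 1) * g)) := by
  linear_combination (2 * N * x * (x - 1) * g - 2 * N * x ^ 2 * g) * he -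
    (2 * N * x * (x - 1) * g) * hbe - ((N - 1) * x * (x - 1) * g) * hb

theorem derivative_geom_sum_ring_identity {R : Type*} [CommRing R] {x y b e σ h s k N B : R}
    (hN : N = (k + 2) * (s + 3)) (hb : (x - 1) * b = x ^ 2 * y - 1) (hσ : σ = e - 1)
    (hbe : b = e + y + x * y) (hB : (x - 1) * B + b = (s + 3) * (x * y)) :
    (1 - x) * (x * ((N * ((s + 3) * (x * y) + 1) - 2 * b - 2 * x * B) * ((x ^ 2 * y - 1) * h) +
        (N * (x ^ 2 * y + x) - 2 * x * b) * ((k + 1) * (h * ((s + 3) * (x * y))))) -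
        (N * (x ^ 2 * y + x) - 2 * x * b) * ((x ^ 2 * y - 1) * h)) +
        (N - 1) * x * ((N * (x ^ 2 * y + x) - 2 * x * b) * ((x ^ 2 * y - 1) * h)) =
      N * (x * (x * ((s * y + s - 2 * σ) * ((x ^ 2 * y - 1) * h))) +
        ((s + 3) * (k + 1)) * (x * (x * ((y ^ 2 * x ^ 2 - 1) * h)))) := by
  subst hσ hN
  linear_combination (2 * x ^ 2 * (x ^ 2 * y - 1) * h) * hB +
    (2 * (k + 1) * (s + 3) * x ^ 3 * y * h) * hb -
    (2 * (k + 2) * (s + 3) * x ^ 2 * (x ^ 2 * y - 1) * h) * hbe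

theorem binomOp_regular_type_identity_aux (s k m : ℕ) (y b e σ g h N : ℚ[X])
    (hN : N = ((k : ℚ[X]) + 2) * ((s : ℚ[X]) + 3)) (hm : N = (m : ℚ[X]) + 3)
    (hg : g = (X ^ 2 * y - 1) * h)
    (hb : (X - 1) * b = X ^ 2 * y - 1) (he : (X - 1) * e = y - 1)
    (hσ : σ = e - 1) (hbe : b = e + y + X * y)
    (hdN : derivative N = 0)
    (hdb : (X - 1) * derivative b + b = ((s : ℚ[X]) + 3) * (X * y))
    (hdy : derivative (X ^ 2 * y) = ((s : ℚ[X]) + 3) * (X * y))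
    (hdF : derivative ((X ^ 2 * y - 1) * g) =
      ((k : ℚ[X]) + 2) * (g * (((s : ℚ[X]) + 3) * (X * y))))
    (hdg : derivative g = ((k : ℚ[X]) + 1) * (h * (((s : ℚ[X]) + 3) * (X * y)))) :
    N * (2 * X * binomOp (-2) (m + 2) (X * (X * ((y - 1) * g))) +
      binomOp (-2) (m + 2) (X * (X * (((s : ℚ[X]) * y + (s : ℚ[X]) - 2 * σ) * g))) +
      ((s : ℚ[X]) + 3) * ((k : ℚ[X]) + 1) *
        binomOp (-2) (m + 2) (X * (X * ((y ^ 2 * X ^ 2 - 1) * h)))) =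
    2 * X ^ 2 * binomOp (-2) (m + 2) ((X - 1) * ((X ^ 2 * y - 1) * g)) +
      X * (X + 1) * binomOp (-2) (m + 2) ((X - 1) * ((X - 1) * ((X ^ 2 * y - 1) * g))) := by
  obtain ⟨Λ, hΛ⟩ : ∃ Λ : ℚ[X] →ₗ[ℚ] ℚ[X], Λ = binomOp (-2) (m + 2) := ⟨_, rfl⟩
  have hD : ∀ f : ℚ[X], X * Λ ((X - 1) * f) =
      Λ ((1 - X) * (X * derivative f - f) + (N - 1) * X * f) := fun f => by
    have hcoef : (C (((-2 : ℤ) : ℚ) + 1) : ℚ[X]) = -1 := by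
      rw [← C_1, ← C_neg]; norm_num
    have hcoef2 : (C ((m + 2 : ℕ) : ℚ) : ℚ[X]) = N - 1 := by
      rw [C_eq_natCast, hm]; push_cast; ring
    rw [hΛ, X_mul_binomOp, hcoef, hcoef2, neg_one_mul, ← sub_eq_add_neg]
  rw [← hΛ]
  clear hΛ
  have hC : ∀ (c : ℕ) (f : ℚ[X]), (c : ℚ[X]) * Λ f = Λ ((c : ℚ[X]) * f) := fun c f => by
    rw [← nsmul_eq_mul, ← map_nsmul, nsmul_eq_mul]
  have hNΛ : ∀ f : ℚ[X], N * Λ f = Λ (N * f) := fun f => by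
    have := hC (m + 3) f
    push_cast at this
    rwa [← hm] at this
  have h2Λ : ∀ f : ℚ[X], 2 * Λ f = Λ (2 * f) := fun f => by
    have := hC 2 f
    push_cast at this
    exact this
  have hskΛ : ∀ f : ℚ[X], ((s : ℚ[X]) + 3) * ((k : ℚ[X]) + 1) * Λ f =
      Λ (((s : ℚ[X]) + 3) * ((k : ℚ[X]) + 1) * f) := fun f => by
    have := hC ((s + 3) * (k + 1)) f
    push_cast at this
    exact this
  have hdq : derivative (N * (X ^ 2 * y + X) - 2 * X * b) =
      N * (((s : ℚ[X]) + 3) * (X * y) + 1) - 2 * b - 2 * X * derivative b := by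
    rw [derivative_sub, derivative_mul, hdN, derivative_add, hdy, derivative_X, derivative_mul,
      derivative_mul, derivative_X, derivative_ofNat]
    ring
  have h1 : X * Λ ((X - 1) * ((X + 1) * ((X ^ 2 * y - 1) * g))) =
      Λ ((X - 1) * ((X ^ 2 * y - 1) * g - (X + 1) * N * (X ^ 2 * y) * g +
        (N - 1) * X * (X + 1) * b * g)) := by
    rw [hD, derivative_mul, hdF, derivative_add, derivative_X, derivative_one]
    exact congrArg Λ (derivative_add_one_mul_ring_identity hN hb)
  have h2 : Λ ((X - 1) * ((X + 1) * ((X ^ 2 * y - 1) * g))) =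
      2 * Λ ((X - 1) * ((X ^ 2 * y - 1) * g)) +
        Λ ((X - 1) * ((X - 1) * ((X ^ 2 * y - 1) * g))) := by
    rw [h2Λ, ← map_add]
    exact congrArg Λ (by ring)
  have h3 : Λ ((X - 1) * ((N * (X ^ 2 * y + X) - 2 * X * b) * g)) +
      2 * (N * Λ (X * (X * ((y - 1) * g)))) =
      Λ ((X - 1) * ((X ^ 2 * y - 1) * g - (X + 1) * N * (X ^ 2 * y) * g +
        (N - 1) * X * (X + 1) * b * g)) +
        Λ ((X - 1) * ((X - 1) * ((X ^ 2 * y - 1) * g))) := by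
    rw [hNΛ, h2Λ, ← map_add, ← map_add]
    exact congrArg Λ (geom_sum_combination_ring_identity hb he hbe)
  have h4 : X * Λ ((X - 1) * ((N * (X ^ 2 * y + X) - 2 * X * b) * g)) =
      N * (Λ (X * (X * (((s : ℚ[X]) * y + (s : ℚ[X]) - 2 * σ) * g))) +
        ((s : ℚ[X]) + 3) * ((k : ℚ[X]) + 1) * Λ (X * (X * ((y ^ 2 * X ^ 2 - 1) * h)))) := by
    rw [hskΛ, ← map_add, hNΛ, hD, derivative_mul, hdq, hdg, hg]
    exact congrArg Λ (derivative_geom_sum_ring_identity hN hb hσ hbe hdb)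
  linear_combination X * h3 - X * h1 + X * X * h2 - h4

theorem binomOp_regular_type_identity (s k m : ℕ) (hN : m + 3 = (k + 2) * (s + 3)) :
    ((m + 3 : ℕ) : ℚ) •
      (2 * X * binomOp 0 (m + 2) ((X ^ (s + 1) - 1) * (X ^ (s + 3) - 1) ^ (k + 1)) +
        ∑ i ∈ Finset.range s, binomOp 0 (m + 2)
          ((X ^ (s - i) - 1) * (X ^ (i + 1) - 1) * (X ^ (s + 3) - 1) ^ (k + 1)) +
        ((s + 3) * (k + 1 : ℕ) : ℚ) • binomOp 0 (m + 2)
          ((X ^ (2 * s + 4) - 1) * (X ^ (s + 3) - 1) ^ k)) =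
      2 * X ^ 2 * binomOp (-2) (m + 1) ((X ^ (s + 3) - 1) ^ (k + 2)) +
        X * (X + 1) * binomOp (-2) m ((X ^ (s + 3) - 1) ^ (k + 2)) := by
  have hshift : ∀ f : ℚ[X], binomOp 0 (m + 2) f = binomOp (-2) (m + 2) (X * (X * f)) := fun f => by
    rw [binomOp_X_mul, binomOp_X_mul]
    rfl
  have hlow := binomOp_X_sub_one_mul (-2)
  set y : ℚ[X] := X ^ (s + 1) with hy
  set b : ℚ[X] := ∑ i ∈ Finset.range (s + 3), X ^ i with hb
  set e : ℚ[X] := ∑ i ∈ Finset.range (s + 1), X ^ i with he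
  set σ : ℚ[X] := ∑ i ∈ Finset.range s, X ^ (i + 1) with hσ
  have hp : (X : ℚ[X]) ^ (s + 3) = X ^ 2 * y := by rw [hy]; ring
  have hp2 : (X : ℚ[X]) ^ (2 * s + 4) = y ^ 2 * X ^ 2 := by rw [hy]; ring
  have hb1 : (X - 1) * b = X ^ 2 * y - 1 := by rw [hb, mul_geom_sum, hp]
  have he1 : (X - 1) * e = y - 1 := by rw [he, mul_geom_sum]
  have hσe : e = σ + 1 := by rw [he, hσ, Finset.sum_range_succ', pow_zero]
  have hbe : b = e + y + X * y := by
    rw [hb, Finset.sum_range_succ, Finset.sum_range_succ, ← he, hy]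
    ring
  have hdy : derivative (X ^ 2 * y) = ((s : ℚ[X]) + 3) * (X * y) := by
    rw [← hp, derivative_X_pow, hy, C_eq_natCast,
      show s + 3 - 1 = s + 1 + 1 by omega]
    push_cast
    ring
  have hb2 : (X - 1) * derivative b + b = ((s : ℚ[X]) + 3) * (X * y) := by
    have h := congrArg derivative hb1
    rw [derivative_mul, derivative_sub, derivative_sub, derivative_X, derivative_one, hdy] at h
    linear_combination h
  rw [hp, hp2]
  set h : ℚ[X] := (X ^ 2 * y - 1) ^ k with hh
  have hF : (X ^ 2 * y - 1) ^ (k + 2) = (X ^ 2 * y - 1) * ((X ^ 2 * y - 1) * h) := by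
    rw [hh]; ring
  have hg : (X ^ 2 * y - 1) ^ (k + 1) = (X ^ 2 * y - 1) * h := by
    rw [hh]; ring
  have hda : derivative (X ^ 2 * y - 1) = ((s : ℚ[X]) + 3) * (X * y) := by
    rw [derivative_sub, hdy, derivative_one, sub_zero]
  have hdF : derivative ((X ^ 2 * y - 1) * ((X ^ 2 * y - 1) * h)) =
      ((k : ℚ[X]) + 2) * (((X ^ 2 * y - 1) * h) * (((s : ℚ[X]) + 3) * (X * y))) := by
    rw [← hF, derivative_pow_succ, hda, hg, C_add, C_1, C_eq_natCast]
    push_cast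
    ring
  have hdg : derivative ((X ^ 2 * y - 1) * h) =
      ((k : ℚ[X]) + 1) * (h * (((s : ℚ[X]) + 3) * (X * y))) := by
    rw [← hg, derivative_pow_succ, hda, C_add, C_1, C_eq_natCast]
    ring
  have hNC : ((m : ℚ[X]) + 3) = ((k : ℚ[X]) + 2) * ((s : ℚ[X]) + 3) := by
    exact_mod_cast congrArg (Nat.cast) hN
  have hT2 : ∑ i ∈ Finset.range s, binomOp 0 (m + 2)
      ((X ^ (s - i) - 1) * (X ^ (i + 1) - 1) * ((X ^ 2 * y - 1) * h)) =
      binomOp (-2) (m + 2)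
        (X * (X * (((s : ℚ[X]) * y + (s : ℚ[X]) - 2 * σ) * ((X ^ 2 * y - 1) * h)))) := by
    rw [← map_sum, ← Finset.sum_mul, sum_X_pow_sub_one_mul, hshift]
  have hdN : derivative ((m : ℚ[X]) + 3) = 0 := by
    have := derivative_natCast (R := ℚ) (n := m + 3)
    push_cast at this
    exact this
  have key := binomOp_regular_type_identity_aux s k m y b e σ _ h _ hNC rfl rfl hb1 he1
    (by rw [hσe]; ring) hbe hdN hb2 hdy hdF hdg
  rw [hg, hF, hT2, hshift, hshift]
  simp only [smul_eq_C_mul, C_mul, C_add, C_eq_natCast, map_ofNat]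
  push_cast
  rw [hlow (m + 1), hlow (m + 1), hlow m] at key
  exact key

end RegularType

/-- For `p ≥ 3`, `n ≥ 2`, `N = np`,
`P_{[2,N−2],[p^n]}(x) = Σ_{i=0}^n (−1)^{n−i} C(n,i)[2x²·binom(x−2+pi, N−2) + x(x+1)·binom(x−2+pi, N−3)]`. -/
theorem Pperm_regular_type_formula (p n : ℕ) (hp : 3 ≤ p) (hn : 2 ≤ n)
    (α : Equiv.Perm (Fin (n * p))) (hα : fullCycleType α = ({2, n * p - 2} : Multiset ℕ)) :
    Pperm α (Multiset.replicate n p) =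
      ∑ i ∈ Finset.range (n + 1), ((-1 : ℚ) ^ (n - i) * (n.choose i : ℚ)) •
        (2 * Polynomial.X ^ 2 * binomPoly ((p : ℤ) * i - 2) ((n * p : ℤ) - 2)
          + Polynomial.X * (Polynomial.X + 1) *
              binomPoly ((p : ℤ) * i - 2) ((n * p : ℤ) - 3)) := by
  obtain ⟨s, rfl⟩ := Nat.exists_eq_add_of_le' hp
  obtain ⟨k, rfl⟩ := Nat.exists_eq_add_of_le' hn
  obtain ⟨m, hm⟩ : ∃ m, (k + 2) * (s + 3) = m + 3 := ⟨k * (s + 3) + 2 * s + 3, by ring⟩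
  have hP : Pperm α (Multiset.replicate (k + 2) (s + 3)) =
      2 * X ^ 2 * binomOp (-2) (m + 1) ((X ^ (s + 3) - 1) ^ (k + 2)) +
        X * (X + 1) * binomOp (-2) m ((X ^ (s + 3) - 1) ^ (k + 2)) := by
    rw [← binomOp_regular_type_identity s k m hm.symm]
    have hm' := hm
    generalize (k + 2) * (s + 3) = N at α hm hα
    subst hm
    exact Equiv.Perm.Pperm_eq s (k + 1) m hm'.symm α hα
  have h2 : (((k + 2 : ℕ) : ℤ) * ((s + 3 : ℕ) : ℤ)) - 2 = ((m + 1 : ℕ) : ℤ) := by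
    rw [← Nat.cast_mul, hm]; push_cast; ring
  have h3 : (((k + 2 : ℕ) : ℤ) * ((s + 3 : ℕ) : ℤ)) - 3 = (m : ℤ) := by
    rw [← Nat.cast_mul, hm]; push_cast; ring
  rw [hP, h2, h3, binomOp_X_pow_sub_one_pow, binomOp_X_pow_sub_one_pow, Finset.mul_sum,
    Finset.mul_sum, ← Finset.sum_add_distrib]
  refine Finset.sum_congr rfl fun i _ => ?_
  rw [smul_add, mul_smul_comm, mul_smul_comm, sub_eq_add_neg]
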